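/- arXiv:1607.02390 — 2 statements merged into one kernel-verified Lean document; each statement's English description precedes it below -/
import Mathlib

section
/- Let p ≥ 2 be an integer, c > 0, and suppose E_p^-, E_p^+, E_{p+1}^- are reals ≤ 0 satisfying the band-edge characterizations: −c − E_p^- lies in (−𝔞_p, −c̃_{p−1}] and E_p^- solves u'(−c−E)v'(−E) = v'(−c−E)u'(−E) if p is even, v'(−E)u(−c−E) = u'(−E)v(−c−E) if p is odd; −c − E_p^+ lies in [−c_p, −𝔞_p) and E_p^+ solves v(−E)u'(−c−E) = u(−E)v'(−c−E) if p is even, u(−E)v(−c−E) = v(−E)u(−c−E) if p is odd; −c − E_{p+1}^- lies in (−𝔞_{p+1}, −c̃_p] and E_{p+1}^- solves the corresponding equation for the parity of p+1. Then the p-th rescaled band width δ_p = E_p^+ − E_p^- satisfies 0 < δ_p ≤ (π/3 + (7/(3π))·(p+1/3)/(p·(p+2/3)))·(3/π)^(1/3)·p^(−1/3), and the p-th rescaled gap width γ_p = E_{p+1}^- − E_p^+ satisfies I((7/6)^(2/3))·(2^(1/3)·π^(2/3)/9)·(p+1)^(−1/3) < γ_p ≤ (π + (7/(3π))·p/(p²−1))·(3/π)^(1/3)·(p−1)^(−1/3);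 in particular all these spectral gaps are open. -/
open Real Set

/-- The standard Airy function `Ai` expressed in the basis of the canonical
solutions `u`, `v` of the Airy equation. -/
noncomputable def AiF (u v : ℝ → ℝ) (x : ℝ) : ℝ :=
  u x / ((3:ℝ) ^ ((2:ℝ)/3) * Real.Gamma (2/3))
    - v x / ((3:ℝ) ^ ((1:ℝ)/3) * Real.Gamma (1/3))

/-- Derivative of the standard Airy function in the same basis. -/
noncomputable def AiD (u' v' : ℝ → ℝ) (x : ℝ) : ℝ :=
  u' x / ((3:ℝ) ^ ((2:ℝ)/3) * Real.Gamma (2/3))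
    - v' x / ((3:ℝ) ^ ((1:ℝ)/3) * Real.Gamma (1/3))

/-- `𝔞_{2j} = ã_{j+1}` and `𝔞_{2j+1} = a_{j+1}`. -/
noncomputable def frak (a ta : ℕ → ℝ) (p : ℕ) : ℝ :=
  if p % 2 = 0 then ta (p / 2 + 1) else a (p / 2 + 1)

/-- `I(y) = (3/2)^(1/3)·(y^(3/2)+1)/(y²+y+1)`. -/
noncomputable def Ifun (y : ℝ) : ℝ :=
  ((3:ℝ)/2) ^ ((1:ℝ)/3) * (y ^ ((3:ℝ)/2) + 1) / (y ^ 2 + y + 1)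

/-- A function with nonnegative derivative on `[a, ∞)` is monotone there. -/
theorem monotoneOn_Ici_of_hasDerivAt {f f' : ℝ → ℝ} {a : ℝ}
    (hf : ∀ x, a ≤ x → HasDerivAt f (f' x) x) (h : ∀ x, a ≤ x → 0 ≤ f' x) :
    MonotoneOn f (Ici a) := by
  apply monotoneOn_of_deriv_nonneg (convex_Ici a)
  · exact fun x hx => (hf x hx).continuousAt.continuousWithinAt
  · intro x hx
    rw [interior_Ici] at hx
    exact (hf x (le_of_lt hx)).differentiableAt.differentiableWithinAt
  · intro x hx
    rw [interior_Ici] at hx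
    rw [(hf x (le_of_lt hx)).deriv]
    exact h x (le_of_lt hx)

/-- First order comparison on `[0, T]`. -/
theorem le_of_hasDerivAt_le {f f' g g' : ℝ → ℝ} {T : ℝ}
    (hf : ∀ t, HasDerivAt f (f' t) t) (hg : ∀ t, HasDerivAt g (g' t) t)
    (h0 : f 0 ≤ g 0) (h1 : ∀ t ∈ Icc 0 T, f' t ≤ g' t) :
    ∀ t ∈ Icc 0 T, f t ≤ g t := by
  have hm : MonotoneOn (fun t => g t - f t) (Icc 0 T) := by
    apply monotoneOn_of_deriv_nonneg (convex_Icc 0 T)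
    · exact fun x _ => ((hg x).sub (hf x)).continuousAt.continuousWithinAt
    · exact fun x _ => ((hg x).sub (hf x)).differentiableAt.differentiableWithinAt
    · intro x hx
      rw [interior_Icc] at hx
      rw [((hg x).fun_sub (hf x)).deriv]
      linarith [h1 x (Ioo_subset_Icc_self hx)]
  intro t ht
  have := hm ⟨le_rfl, ht.1.trans ht.2⟩ ht ht.1
  simp only at this
  linarith

/-- Second order comparison on `[0, T]`. -/
theorem le_of_second_deriv_le {f f' f'' g g' g'' : ℝ → ℝ} {T : ℝ}
    (hf : ∀ t, HasDerivAt f (f' t) t) (hf' : ∀ t, HasDerivAt f' (f'' t) t)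
    (hg : ∀ t, HasDerivAt g (g' t) t) (hg' : ∀ t, HasDerivAt g' (g'' t) t)
    (h0 : f 0 ≤ g 0) (h0' : f' 0 ≤ g' 0) (h : ∀ t ∈ Icc 0 T, f'' t ≤ g'' t) :
    ∀ t ∈ Icc 0 T, f' t ≤ g' t ∧ f t ≤ g t := by
  have h1 := le_of_hasDerivAt_le hf' hg' h0' h
  exact fun t ht => ⟨h1 t ht, le_of_hasDerivAt_le hf hg h0 h1 t ht⟩

theorem hasDerivAt_even_poly (a b c t : ℝ) :
    HasDerivAt (fun t : ℝ => 1 + a * t ^ 3 + b * t ^ 6 + c * t ^ 9)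
      (3 * a * t ^ 2 + 6 * b * t ^ 5 + 9 * c * t ^ 8) t := by
  have := ((((hasDerivAt_pow 3 t).const_mul a).const_add 1).add
    ((hasDerivAt_pow 6 t).const_mul b)).add ((hasDerivAt_pow 9 t).const_mul c)
  refine this.congr_deriv ?_
  push_cast; ring

theorem hasDerivAt_even_poly_deriv (a b c t : ℝ) :
    HasDerivAt (fun t : ℝ => 3 * a * t ^ 2 + 6 * b * t ^ 5 + 9 * c * t ^ 8)
      (6 * a * t + 30 * b * t ^ 4 + 72 * c * t ^ 7) t := by
  have := (((hasDerivAt_pow 2 t).const_mul (3 * a)).add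
    ((hasDerivAt_pow 5 t).const_mul (6 * b))).add ((hasDerivAt_pow 8 t).const_mul (9 * c))
  refine this.congr_deriv ?_
  push_cast; ring

theorem hasDerivAt_odd_poly (a b c d t : ℝ) :
    HasDerivAt (fun t : ℝ => t + a * t ^ 4 + b * t ^ 7 + c * t ^ 10 + d * t ^ 13)
      (1 + 4 * a * t ^ 3 + 7 * b * t ^ 6 + 10 * c * t ^ 9 + 13 * d * t ^ 12) t := by
  have := ((((hasDerivAt_id t).add ((hasDerivAt_pow 4 t).const_mul a)).add
    ((hasDerivAt_pow 7 t).const_mul b)).add ((hasDerivAt_pow 10 t).const_mul c)).add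
    ((hasDerivAt_pow 13 t).const_mul d)
  refine this.congr_deriv ?_
  push_cast; ring

theorem hasDerivAt_odd_poly_deriv (a b c d t : ℝ) :
    HasDerivAt (fun t : ℝ =>
        1 + 4 * a * t ^ 3 + 7 * b * t ^ 6 + 10 * c * t ^ 9 + 13 * d * t ^ 12)
      (12 * a * t ^ 2 + 42 * b * t ^ 5 + 90 * c * t ^ 8 + 156 * d * t ^ 11) t := by
  have := (((((hasDerivAt_pow 3 t).const_mul (4 * a)).const_add 1).add
    ((hasDerivAt_pow 6 t).const_mul (7 * b))).add
    ((hasDerivAt_pow 9 t).const_mul (10 * c))).add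
    ((hasDerivAt_pow 12 t).const_mul (13 * d))
  refine this.congr_deriv ?_
  push_cast; ring

/-- The even-type solution of `w'' = -t w` stays positive on `[0, 1.96]`. -/
theorem airy_even_pos {w w' : ℝ → ℝ} (hw : ∀ t, HasDerivAt w (w' t) t)
    (hw' : ∀ t, HasDerivAt w' (-t * w t) t) (h0 : w 0 = 1) (h0' : w' 0 = 0) :
    ∀ t ∈ Icc (0:ℝ) (49/25), 0 < w t := by
  have key : ∀ T ∈ Icc (0:ℝ) (49/25), (∀ t ∈ Icc 0 T, 0 ≤ w t) → 0 < w T := by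
    intro T hT hpos
    have e1 := le_of_second_deriv_le (T := T) hw hw' (hasDerivAt_even_poly 0 0 0)
      (hasDerivAt_even_poly_deriv 0 0 0) (by simp [h0]) (by simp [h0']) (by
        intro t ht
        have := mul_nonneg ht.1 (hpos t ht)
        linarith)
    have e2 := le_of_second_deriv_le (T := T) (hasDerivAt_even_poly (-1/6) 0 0)
      (hasDerivAt_even_poly_deriv (-1/6) 0 0) hw hw' (by simp [h0]) (by simp [h0']) (by
        intro t ht
        have := mul_le_mul_of_nonneg_left (e1 t ht).2 ht.1
        linarith)
    have e3 := le_of_second_deriv_le (T := T) hw hw' (hasDerivAt_even_poly (-1/6) (1/180) 0)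
      (hasDerivAt_even_poly_deriv (-1/6) (1/180) 0) (by simp [h0]) (by simp [h0']) (by
        intro t ht
        have := mul_le_mul_of_nonneg_left (e2 t ht).2 ht.1
        linarith)
    have e4 := le_of_second_deriv_le (T := T) (hasDerivAt_even_poly (-1/6) (1/180) (-1/12960))
      (hasDerivAt_even_poly_deriv (-1/6) (1/180) (-1/12960)) hw hw' (by simp [h0])
      (by simp [h0']) (by
        intro t ht
        have := mul_le_mul_of_nonneg_left (e3 t ht).2 ht.1
        linarith)
    refine lt_of_lt_of_le ?_ (e4 T ⟨hT.1, le_rfl⟩).2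
    have hy0 : 0 ≤ T ^ 3 := pow_nonneg hT.1 3
    have hy1 : T ^ 3 ≤ 753/100 := (pow_le_pow_left₀ hT.1 hT.2 3).trans (by norm_num)
    have h6 : T ^ 6 = (T ^ 3) ^ 2 := by ring
    have h9 : T ^ 9 = (T ^ 3) ^ 3 := by ring
    rw [h6, h9]
    generalize T ^ 3 = y at *
    nlinarith [mul_nonneg hy0 (sub_nonneg.2 hy1), mul_nonneg hy0 (mul_nonneg hy0 (sub_nonneg.2 hy1)), mul_nonneg (sub_nonneg.2 hy1) (sub_nonneg.2 hy1)]
  by_contra! hcon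
  obtain ⟨t, ht, hwt⟩ := hcon
  have hcont : Continuous w := continuous_iff_continuousAt.2 fun t => (hw t).continuousAt
  have hcomp : IsCompact (Icc (0:ℝ) (49/25) ∩ {t | w t ≤ 0}) :=
    isCompact_Icc.inter_right (isClosed_le hcont continuous_const)
  obtain ⟨m, ⟨hm, hwm⟩, hmin⟩ := hcomp.exists_isLeast ⟨t, ht, hwt⟩
  rcases eq_or_lt_of_le hm.1 with h | h
  · simp only [mem_ofPred_eq, ← h, h0] at hwm
    linarith
  refine absurd (key m hm ?_) (not_lt.2 hwm)
  have hlt : ∀ s ∈ Ico 0 m, 0 ≤ w s := by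
    intro s hs
    by_contra! hneg
    exact absurd (hmin ⟨⟨hs.1, hs.2.le.trans hm.2⟩, hneg.le⟩) (not_le.2 hs.2)
  intro s hs
  have : closure (Ico 0 m) ⊆ {s | 0 ≤ w s} :=
    closure_minimal hlt (isClosed_le continuous_const hcont)
  rw [closure_Ico h.ne] at this
  exact this hs

/-- The odd-type solution of `W'' = -t W` at `1.96`, assuming nonnegativity up to there. -/
theorem airy_odd_bounds {w w' : ℝ → ℝ} (hw : ∀ t, HasDerivAt w (w' t) t)
    (hw' : ∀ t, HasDerivAt w' (-t * w t) t) (h0 : w 0 = 0) (h0' : w' 0 = 1)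
    (hpos : ∀ t ∈ Icc (0:ℝ) (49/25), 0 ≤ w t) :
    0 < w (49/25) ∧ w (49/25) ≤ 0.951 ∧ w' (49/25) ≤ -0.81 := by
  have e1 := le_of_second_deriv_le (T := 49/25) hw hw' (hasDerivAt_odd_poly 0 0 0 0)
    (hasDerivAt_odd_poly_deriv 0 0 0 0) (by simp [h0]) (by simp [h0']) (by
      intro t ht
      have := mul_nonneg ht.1 (hpos t ht)
      linarith)
  have e2 := le_of_second_deriv_le (T := 49/25) (hasDerivAt_odd_poly (-1/12) 0 0 0)
    (hasDerivAt_odd_poly_deriv (-1/12) 0 0 0) hw hw' (by simp [h0]) (by simp [h0']) (by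
      intro t ht
      have := mul_le_mul_of_nonneg_left (e1 t ht).2 ht.1
      linarith)
  have e3 := le_of_second_deriv_le (T := 49/25) hw hw' (hasDerivAt_odd_poly (-1/12) (1/504) 0 0)
    (hasDerivAt_odd_poly_deriv (-1/12) (1/504) 0 0) (by simp [h0]) (by simp [h0']) (by
      intro t ht
      have := mul_le_mul_of_nonneg_left (e2 t ht).2 ht.1
      linarith)
  have e4 := le_of_second_deriv_le (T := 49/25)
    (hasDerivAt_odd_poly (-1/12) (1/504) (-1/45360) 0)
    (hasDerivAt_odd_poly_deriv (-1/12) (1/504) (-1/45360) 0) hw hw' (by simp [h0])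
    (by simp [h0']) (by
      intro t ht
      have := mul_le_mul_of_nonneg_left (e3 t ht).2 ht.1
      linarith)
  have e5 := le_of_second_deriv_le (T := 49/25) hw hw'
    (hasDerivAt_odd_poly (-1/12) (1/504) (-1/45360) (1/7076160))
    (hasDerivAt_odd_poly_deriv (-1/12) (1/504) (-1/45360) (1/7076160)) (by simp [h0])
    (by simp [h0']) (by
      intro t ht
      have := mul_le_mul_of_nonneg_left (e4 t ht).2 ht.1
      linarith)
  have hmem : (49/25 : ℝ) ∈ Icc (0:ℝ) (49/25) := by constructor <;> norm_num
  refine ⟨lt_of_lt_of_le ?_ (e2 _ hmem).2, (e3 _ hmem).2.trans ?_, (e5 _ hmem).1.trans ?_⟩ <;>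
    norm_num

/-- Prüfer angle for the system `A' = -2s²B`, `B' = B/s + 2s²A`, which is the equation
`w'' = -t w` in the variables `t = s²`, `A = w'(t)`, `B = √t w(t)`. -/
theorem exists_pruefer_angle {A B : ℝ → ℝ} {s₀ θ₀ R₀ : ℝ} (hs₀ : 0 < s₀)
    (hA : ∀ s, 0 < s → HasDerivAt A (-2 * s ^ 2 * B s) s)
    (hB : ∀ s, 0 < s → HasDerivAt B (B s / s + 2 * s ^ 2 * A s) s)
    (hne : ∀ s, 0 < s → 0 < A s ^ 2 + B s ^ 2)
    (hR₀ : 0 < R₀) (hA₀ : A s₀ = R₀ * cos θ₀) (hB₀ : B s₀ = R₀ * sin θ₀) :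
    ∃ θ R : ℝ → ℝ, θ s₀ = θ₀ ∧ ∀ s, s₀ ≤ s → 0 < R s ∧ A s = R s * cos (θ s) ∧
      B s = R s * sin (θ s) ∧
      HasDerivAt θ (2 * s ^ 2 + sin (θ s) * cos (θ s) / s) s := by
  set g : ℝ → ℝ := fun s => 2 * s ^ 2 + A s * B s / (s * (A s ^ 2 + B s ^ 2)) with hg
  have hgc : ContinuousOn g (Ioi 0) := by
    intro s hs
    have h1 := (hA s hs).continuousAt
    have h2 := (hB s hs).continuousAt
    have h3 : s * (A s ^ 2 + B s ^ 2) ≠ 0 := (mul_pos hs (hne s hs)).ne'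
    have h4 : ContinuousAt (fun s => s * (A s ^ 2 + B s ^ 2)) s := by fun_prop
    have h5 : ContinuousAt (fun s : ℝ => 2 * s ^ 2) s := by fun_prop
    exact (h5.add ((h1.mul h2).div h4 h3)).continuousWithinAt
  set θ : ℝ → ℝ := fun s => θ₀ + ∫ x in s₀..s, g x with hθ
  have hθd : ∀ s, 0 < s → HasDerivAt θ (g s) s := by
    intro s hs
    refine HasDerivAt.const_add _ (intervalIntegral.integral_hasDerivAt_right ?_ ?_ ?_)
    · refine (hgc.mono ?_).intervalIntegrable
      intro x hx
      exact lt_of_lt_of_le (lt_min hs₀ hs) hx.1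
    · exact hgc.stronglyMeasurableAtFilter isOpen_Ioi s hs
    · exact hgc.continuousAt (Ioi_mem_nhds hs)
  have hθ0 : θ s₀ = θ₀ := by simp [hθ]
  set P : ℝ → ℝ := fun s => A s * sin (θ s) - B s * cos (θ s) with hP
  set Q : ℝ → ℝ := fun s => A s * cos (θ s) + B s * sin (θ s) with hQ
  have hPd : ∀ s, 0 < s → HasDerivAt P (B s ^ 2 / (s * (A s ^ 2 + B s ^ 2)) * P s) s := by
    intro s hs
    have h := ((hA s hs).mul (hθd s hs).sin).sub ((hB s hs).mul (hθd s hs).cos)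
    refine h.congr_deriv ?_
    have h1 := (hne s hs).ne'
    have h2 := hs.ne'
    simp only [hg, hP]
    field_simp
    ring
  have hPz : ∀ s, s₀ ≤ s → P s = 0 := by
    have hm := monotoneOn_Ici_of_hasDerivAt (a := s₀) (f := fun s => -(P s ^ 2 / s ^ 2))
      (f' := fun s => 2 * P s ^ 2 / s ^ 3 * (A s ^ 2 / (A s ^ 2 + B s ^ 2))) (by
        intro s hs
        have hs' := hs₀.trans_le hs
        have h := (((hPd s hs').pow 2).div (hasDerivAt_pow 2 s) (pow_ne_zero 2 hs'.ne')).neg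
        refine h.congr_deriv ?_
        have h1 := (hne s hs').ne'
        have h2 := hs'.ne'
        simp only [Pi.pow_apply]
        field_simp
        push_cast
        ring) (by
        intro s hs
        have hs' := hs₀.trans_le hs
        have := hne s hs'
        positivity)
    intro s hs
    have h := hm (mem_Ici.2 le_rfl) (mem_Ici.2 hs) hs
    have h0 : P s₀ = 0 := by simp only [hP, hθ0, hA₀, hB₀]; ring
    have hs' := hs₀.trans_le hs
    simp only [h0] at h
    have h3 : P s ^ 2 / s ^ 2 ≤ 0 := by norm_num at h; linarith
    have h4 : 0 ≤ P s ^ 2 / s ^ 2 := by positivity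
    have h5 : P s ^ 2 / s ^ 2 = 0 := le_antisymm h3 h4
    rw [div_eq_zero_iff] at h5
    rcases h5 with h5 | h5
    · exact pow_eq_zero_iff (two_ne_zero) |>.1 h5
    · exact absurd h5 (pow_ne_zero 2 hs'.ne')
  have hQsq : ∀ s, s₀ ≤ s → Q s ^ 2 = A s ^ 2 + B s ^ 2 := by
    intro s hs
    have h := hPz s hs
    simp only [hP] at h
    simp only [hQ]
    linear_combination (A s ^ 2 + B s ^ 2) * sin_sq_add_cos_sq (θ s) -
      (A s * sin (θ s) - B s * cos (θ s)) * h
  have hQpos : ∀ s, s₀ ≤ s → 0 < Q s := by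
    intro s hs
    by_contra! hneg
    have hc : ContinuousOn Q (Icc s₀ s) := by
      intro x hx
      have hx' := hs₀.trans_le hx.1
      have h1 := (hA x hx').continuousAt
      have h2 := (hB x hx').continuousAt
      have h3 := (hθd x hx').continuousAt
      exact ContinuousAt.continuousWithinAt (by fun_prop)
    have h0 : Q s₀ = R₀ := by
      simp only [hQ, hθ0, hA₀, hB₀]
      linear_combination R₀ * sin_sq_add_cos_sq θ₀
    obtain ⟨x, hx, hx0⟩ := intermediate_value_Icc' hs hc ⟨hneg, by rw [h0]; exact hR₀.le⟩
    have := hQsq x hx.1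
    rw [hx0] at this
    linarith [hne x (hs₀.trans_le hx.1)]
  refine ⟨θ, Q, hθ0, fun s hs => ?_⟩
  have hs' := hs₀.trans_le hs
  have hz := hPz s hs
  simp only [hP] at hz
  have hAs : A s = Q s * cos (θ s) := by
    simp only [hQ]
    linear_combination -A s * sin_sq_add_cos_sq (θ s) + sin (θ s) * hz
  have hBs : B s = Q s * sin (θ s) := by
    simp only [hQ]
    linear_combination -B s * sin_sq_add_cos_sq (θ s) - cos (θ s) * hz
  refine ⟨hQpos s hs, hAs, hBs, (hθd s hs').congr_deriv ?_⟩
  have hQs := hQsq s hs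
  have hQne := (hQpos s hs).ne'
  simp only [hg]
  rw [← hQs, hAs, hBs]
  field_simp

theorem pruefer_angle_upper {θ : ℝ → ℝ} {s₀ : ℝ} (hs₀ : 0 < s₀)
    (hθ : ∀ s, s₀ ≤ s → HasDerivAt θ (2 * s ^ 2 + sin (θ s) * cos (θ s) / s) s)
    {s : ℝ} (hs : s₀ ≤ s) :
    θ s - 2 / 3 * s ^ 3 ≤ θ s₀ - 2 / 3 * s₀ ^ 3 + cos (θ s₀) ^ 2 / (4 * s₀ ^ 3) := by
  have hm := monotoneOn_Ici_of_hasDerivAt (a := s₀)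
    (f := fun s => -(θ s - 2 / 3 * s ^ 3 + cos (θ s) ^ 2 / (4 * s ^ 3)))
    (f' := fun s => cos (θ s) ^ 2 * (2 * sin (θ s) ^ 2 + 3) / (4 * s ^ 4)) (by
      intro x hx
      have hx' := (hs₀.trans_le hx).ne'
      have h := (((hθ x hx).sub ((hasDerivAt_pow 3 x).const_mul (2 / 3))).add
        (((hθ x hx).cos.pow 2).div ((hasDerivAt_pow 3 x).const_mul 4)
          (mul_ne_zero four_ne_zero (pow_ne_zero 3 hx')))).neg
      refine h.congr_deriv ?_
      simp only [Pi.pow_apply]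
      field_simp
      push_cast
      ring) (by
      intro x hx
      have := hs₀.trans_le hx
      positivity)
  have h := hm (mem_Ici.2 le_rfl) (mem_Ici.2 hs) hs
  have : 0 ≤ cos (θ s) ^ 2 / (4 * s ^ 3) := by
    have := hs₀.trans_le hs
    positivity
  simp only at h
  linarith

theorem pruefer_angle_lower {θ : ℝ → ℝ} {s₀ : ℝ} (hs₀ : 0 < s₀)
    (hθ : ∀ s, s₀ ≤ s → HasDerivAt θ (2 * s ^ 2 + sin (θ s) * cos (θ s) / s) s)
    {s : ℝ} (hs : s₀ ≤ s) :
    θ s₀ - 2 / 3 * s₀ ^ 3 - sin (θ s₀) ^ 2 / (4 * s₀ ^ 3) ≤ θ s - 2 / 3 * s ^ 3 := by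
  have hm := monotoneOn_Ici_of_hasDerivAt (a := s₀)
    (f := fun s => θ s - 2 / 3 * s ^ 3 - sin (θ s) ^ 2 / (4 * s ^ 3))
    (f' := fun s => sin (θ s) ^ 2 * (3 - 2 * cos (θ s) ^ 2) / (4 * s ^ 4)) (by
      intro x hx
      have hx' := (hs₀.trans_le hx).ne'
      have h := ((hθ x hx).sub ((hasDerivAt_pow 3 x).const_mul (2 / 3))).sub
        (((hθ x hx).sin.pow 2).div ((hasDerivAt_pow 3 x).const_mul 4)
          (mul_ne_zero four_ne_zero (pow_ne_zero 3 hx')))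
      refine h.congr_deriv ?_
      simp only [Pi.pow_apply]
      field_simp
      push_cast
      ring) (by
      intro x hx
      have := hs₀.trans_le hx
      have h1 : 0 ≤ 3 - 2 * cos (θ x) ^ 2 := by nlinarith [cos_sq_le_one (θ x)]
      positivity)
  have h := hm (mem_Ici.2 le_rfl) (mem_Ici.2 hs) hs
  have : 0 ≤ sin (θ s) ^ 2 / (4 * s ^ 3) := by
    have := hs₀.trans_le hs
    positivity
  simp only at h
  linarith

theorem pruefer_angle_strictMonoOn {θ : ℝ → ℝ} {s₀ : ℝ} (hs₀ : 1 ≤ s₀)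
    (hθ : ∀ s, s₀ ≤ s → HasDerivAt θ (2 * s ^ 2 + sin (θ s) * cos (θ s) / s) s) :
    StrictMonoOn θ (Ici s₀) := by
  apply strictMonoOn_of_deriv_pos (convex_Ici s₀)
  · exact fun x hx => (hθ x hx).continuousAt.continuousWithinAt
  · intro x hx
    rw [interior_Ici] at hx
    rw [(hθ x (le_of_lt hx)).deriv]
    have hx1 : 1 < x := lt_of_le_of_lt hs₀ hx
    have h1 : -1 ≤ sin (θ x) * cos (θ x) := by
      nlinarith [sin_sq_add_cos_sq (θ x), sq_nonneg (sin (θ x) + cos (θ x))]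
    have h2 : -1 ≤ sin (θ x) * cos (θ x) / x := by
      rw [le_div_iff₀ (by linarith)]; linarith
    nlinarith

theorem hasDerivAt_comp_sq {f f' : ℝ → ℝ} (hf : ∀ t, HasDerivAt f (f' t) t) (s : ℝ) :
    HasDerivAt (fun s => f (s ^ 2)) (f' (s ^ 2) * (2 * s)) s :=
  ((hf (s ^ 2)).comp s (hasDerivAt_pow 2 s)).congr_deriv (by push_cast; ring)

/-- Prüfer angle, for `t = s² ≥ 1.96`, of a solution of `w'' = -t w` positive at `1.96`. -/
theorem exists_airy_angle {w w' : ℝ → ℝ} (hw : ∀ t, HasDerivAt w (w' t) t)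
    (hw' : ∀ t, HasDerivAt w' (-t * w t) t) (hne : ∀ t, w t ≠ 0 ∨ w' t ≠ 0)
    (hpos : 0 < w (49/25)) :
    ∃ θ R : ℝ → ℝ, StrictMonoOn θ (Ici (7/5)) ∧ 0 ≤ θ (7/5) ∧ θ (7/5) ≤ π ∧
      ∀ s, 7/5 ≤ s → 0 < R s ∧ w' (s ^ 2) = R s * cos (θ s) ∧
        s * w (s ^ 2) = R s * sin (θ s) ∧
        HasDerivAt θ (2 * s ^ 2 + sin (θ s) * cos (θ s) / s) s := by
  set A : ℝ → ℝ := fun s => w' (s ^ 2) with hA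
  set B : ℝ → ℝ := fun s => s * w (s ^ 2) with hB
  have hAd : ∀ s, 0 < s → HasDerivAt A (-2 * s ^ 2 * B s) s := fun s _ =>
    (hasDerivAt_comp_sq hw' s).congr_deriv (by simp only [hB]; ring)
  have hBd : ∀ s, 0 < s → HasDerivAt B (B s / s + 2 * s ^ 2 * A s) s := fun s hs =>
    ((hasDerivAt_id s).mul (hasDerivAt_comp_sq hw s)).congr_deriv
      (by simp only [hA, hB, id]; field_simp)
  have hne' : ∀ s, 0 < s → 0 < A s ^ 2 + B s ^ 2 := by
    intro s hs
    rcases hne (s ^ 2) with h | h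
    · have : B s ≠ 0 := mul_ne_zero hs.ne' h
      positivity
    · have : A s ≠ 0 := h
      positivity
  have h0 : 0 < B (7/5) := by
    have h3 : (7/5 : ℝ) ^ 2 = 49/25 := by norm_num
    simp only [hB, h3]
    positivity
  set Z : ℂ := ⟨A (7/5), B (7/5)⟩ with hZ
  have hR : 0 < ‖Z‖ := by
    rw [norm_pos_iff]
    intro hz
    have : Z.im = 0 := by rw [hz]; rfl
    exact h0.ne' this
  have hc : A (7/5) = ‖Z‖ * cos Z.arg := (Complex.norm_mul_cos_arg Z).symm
  have hs : B (7/5) = ‖Z‖ * sin Z.arg := (Complex.norm_mul_sin_arg Z).symm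
  obtain ⟨θ, R, hθ0, hθ⟩ :=
    exists_pruefer_angle (by norm_num : (0:ℝ) < 7/5) hAd hBd hne' hR hc hs
  refine ⟨θ, R, pruefer_angle_strictMonoOn (by norm_num) fun s hs => (hθ s hs).2.2.2,
    ?_, ?_, hθ⟩
  · rw [hθ0]
    exact Complex.arg_nonneg_iff.2 h0.le
  · rw [hθ0]
    exact Complex.arg_le_pi Z

/-- The canonical solutions of the Airy equation, with their derivatives. -/
structure IsAiryPair (u v u' v' : ℝ → ℝ) : Prop where
  hu : ∀ x, HasDerivAt u (u' x) x
  hu' : ∀ x, HasDerivAt u' (x * u x) x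
  hv : ∀ x, HasDerivAt v (v' x) x
  hv' : ∀ x, HasDerivAt v' (x * v x) x
  u_zero : u 0 = 1
  u'_zero : u' 0 = 0
  v_zero : v 0 = 0
  v'_zero : v' 0 = 1

namespace IsAiryPair

variable {u v u' v' : ℝ → ℝ}

theorem wronskian (h : IsAiryPair u v u' v') (x : ℝ) : u x * v' x - u' x * v x = 1 := by
  have hd : ∀ x, HasDerivAt (fun x => u x * v' x - u' x * v x) 0 x := fun x =>
    (((h.hu x).mul (h.hv' x)).sub ((h.hu' x).mul (h.hv x))).congr_deriv (by ring)
  have := is_const_of_deriv_eq_zero (fun x => (hd x).differentiableAt)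
    (fun x => (hd x).deriv) x 0
  simpa [h.u_zero, h.u'_zero, h.v_zero, h.v'_zero] using this

theorem hasDerivAt_u_neg (h : IsAiryPair u v u' v') (t : ℝ) :
    HasDerivAt (fun t => u (-t)) (-u' (-t)) t :=
  ((h.hu (-t)).comp t (hasDerivAt_neg t)).congr_deriv (by ring)

theorem hasDerivAt_u'_neg (h : IsAiryPair u v u' v') (t : ℝ) :
    HasDerivAt (fun t => -u' (-t)) (-t * u (-t)) t :=
  ((h.hu' (-t)).comp t (hasDerivAt_neg t)).neg.congr_deriv (by ring)

theorem hasDerivAt_v_neg (h : IsAiryPair u v u' v') (t : ℝ) :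
    HasDerivAt (fun t => -v (-t)) (v' (-t)) t :=
  ((h.hv (-t)).comp t (hasDerivAt_neg t)).neg.congr_deriv (by ring)

theorem hasDerivAt_v'_neg (h : IsAiryPair u v u' v') (t : ℝ) :
    HasDerivAt (fun t => v' (-t)) (-t * -v (-t)) t :=
  ((h.hv' (-t)).comp t (hasDerivAt_neg t)).congr_deriv (by ring)

theorem u_neg_pos (h : IsAiryPair u v u' v') : ∀ t ∈ Icc (0:ℝ) (49/25), 0 < u (-t) :=
  airy_even_pos h.hasDerivAt_u_neg h.hasDerivAt_u'_neg (by simp [h.u_zero])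
    (by simp [h.u'_zero])

theorem u'_neg_pos (h : IsAiryPair u v u' v') {t : ℝ} (ht : 0 < t) (ht' : t ≤ 49/25) :
    0 < u' (-t) := by
  have hm : StrictMonoOn (fun t => u' (-t)) (Icc 0 (49/25)) := by
    have hd : ∀ t, HasDerivAt (fun t => u' (-t)) (t * u (-t)) t := fun t =>
      ((h.hu' (-t)).comp t (hasDerivAt_neg t)).congr_deriv (by ring)
    apply strictMonoOn_of_deriv_pos (convex_Icc _ _)
    · exact fun x _ => (hd x).continuousAt.continuousWithinAt
    · intro x hx
      rw [interior_Icc] at hx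
      rw [(hd x).deriv]
      exact mul_pos hx.1 (h.u_neg_pos x (Ioo_subset_Icc_self hx))
  have := hm ⟨le_rfl, by norm_num⟩ ⟨ht.le, ht'⟩ ht
  simpa [h.u'_zero] using this

theorem v_neg_nonneg (h : IsAiryPair u v u' v') : ∀ t ∈ Icc (0:ℝ) (49/25), 0 ≤ -v (-t) := by
  intro t ht
  have hm : MonotoneOn (fun t => -v (-t) / u (-t)) (Icc 0 (49/25)) := by
    have hd : ∀ t ∈ Icc (0:ℝ) (49/25),
        HasDerivAt (fun t => -v (-t) / u (-t)) (1 / u (-t) ^ 2) t := by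
      intro t ht
      refine ((h.hasDerivAt_v_neg t).div (h.hasDerivAt_u_neg t)
        (h.u_neg_pos t ht).ne').congr_deriv ?_
      rw [← h.wronskian (-t)]
      ring
    apply monotoneOn_of_deriv_nonneg (convex_Icc _ _)
    · exact fun x hx => (hd x hx).continuousAt.continuousWithinAt
    · intro x hx
      rw [interior_Icc] at hx
      exact (hd x (Ioo_subset_Icc_self hx)).differentiableAt.differentiableWithinAt
    · intro x hx
      rw [interior_Icc] at hx
      rw [(hd x (Ioo_subset_Icc_self hx)).deriv]
      positivity
  have h1 := hm ⟨le_rfl, by norm_num⟩ ht ht.1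
  have h2 : 0 ≤ -v (-t) / u (-t) := by simpa [h.v_zero] using h1
  have h3 := h.u_neg_pos t ht
  have := mul_nonneg h2 h3.le
  rwa [div_mul_cancel₀ _ h3.ne'] at this

theorem exists_angle_u (h : IsAiryPair u v u' v') :
    ∃ θ R : ℝ → ℝ, StrictMonoOn θ (Ici (7/5)) ∧ π / 2 < θ (7/5) ∧
      ∀ s, 7/5 ≤ s → 0 < R s ∧ -u' (-s ^ 2) = R s * cos (θ s) ∧
        s * u (-s ^ 2) = R s * sin (θ s) ∧ θ s ≤ 2 / 3 * s ^ 3 + π - 1.738 := by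
  obtain ⟨θ, R, hmono, harg0, harg1, hθ⟩ := exists_airy_angle h.hasDerivAt_u_neg
    h.hasDerivAt_u'_neg (by
      intro t
      by_contra! hcon
      have hw := h.wronskian (-t)
      rw [hcon.1, neg_eq_zero.1 hcon.2] at hw
      norm_num at hw) (h.u_neg_pos (49/25) ⟨by norm_num, le_rfl⟩)
  have hcos : cos (θ (7/5)) < 0 := by
    obtain ⟨hR, h1, -⟩ := hθ (7/5) le_rfl
    have h2 := h.u'_neg_pos (t := (7/5) ^ 2) (by norm_num) (by norm_num)
    by_contra! hcon
    linarith [mul_nonneg hR.le hcon]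
  have hhalf : π / 2 < θ (7/5) := by
    by_contra! hcon
    exact absurd (cos_nonneg_of_neg_pi_div_two_le_of_le (by linarith [pi_pos]) hcon)
      (not_le.2 hcos)
  refine ⟨θ, R, hmono, hhalf, fun s hs => ?_⟩
  refine ⟨(hθ s hs).1, (hθ s hs).2.1, (hθ s hs).2.2.1, ?_⟩
  have := pruefer_angle_upper (by norm_num) (fun s hs => (hθ s hs).2.2.2) hs
  have h2 := cos_sq_le_one (θ (7/5))
  norm_num at this ⊢
  linarith

theorem exists_angle_v (h : IsAiryPair u v u' v') :
    ∃ θ R : ℝ → ℝ, StrictMonoOn θ (Ici (7/5)) ∧ θ (7/5) ≤ π ∧ ContinuousOn θ (Ici (7/5)) ∧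
      ∀ s, 7/5 ≤ s → 0 < R s ∧ v' (-s ^ 2) = R s * cos (θ s) ∧
        s * -v (-s ^ 2) = R s * sin (θ s) ∧ 2 / 3 * s ^ 3 + 2 * π / 3 - 1.898 ≤ θ s := by
  obtain ⟨hb1, hb2, hb3⟩ := airy_odd_bounds h.hasDerivAt_v_neg h.hasDerivAt_v'_neg
    (by simp [h.v_zero]) (by simp [h.v'_zero]) h.v_neg_nonneg
  obtain ⟨θ, R, hmono, harg0, harg1, hθ⟩ := exists_airy_angle h.hasDerivAt_v_neg
    h.hasDerivAt_v'_neg (by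
      intro t
      by_contra! hcon
      have hw := h.wronskian (-t)
      rw [hcon.2, neg_eq_zero.1 hcon.1] at hw
      norm_num at hw) hb1
  obtain ⟨hR, hc, hs, -⟩ := hθ (7/5) le_rfl
  have h49 : (7/5 : ℝ) ^ 2 = 49/25 := by norm_num
  rw [h49] at hc hs
  set φ := θ (7/5) with hφ
  set r := R (7/5) with hr
  have h3 : (1.732:ℝ) < √3 := by
    rw [Real.lt_sqrt (by norm_num)]; norm_num
  have hAB : r * sin φ + √3 * (r * cos φ) < 0 := by
    rw [← hc, ← hs]
    norm_num at *
    nlinarith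
  have hsc : sin (φ + π / 3) < 0 := by
    rw [sin_add, cos_pi_div_three, sin_pi_div_three]
    by_contra! hcon
    have := mul_nonneg hR.le hcon
    linarith
  have hφ1 : 2 * π / 3 ≤ φ := by
    by_contra! hcon
    exact absurd (sin_nonneg_of_nonneg_of_le_pi (by linarith [pi_pos]) (by linarith))
      (not_le.2 hsc)
  have hsq : sin φ ^ 2 ≤ 3 / 4 := by
    have hsin : 0 ≤ sin φ := sin_nonneg_of_nonneg_of_le_pi harg0 harg1
    have h4 : √3 ^ 2 = 3 := Real.sq_sqrt (by norm_num)
    have h5 : sin φ + √3 * cos φ < 0 := by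
      by_contra! hcon
      have := mul_nonneg hR.le hcon
      linarith
    nlinarith [sin_sq_add_cos_sq φ]
  have hder := fun s hs => (hθ s hs).2.2.2
  refine ⟨θ, R, hmono, harg1,
    fun s hs => (hder s hs).continuousAt.continuousWithinAt, fun s hs => ?_⟩
  refine ⟨(hθ s hs).1, (hθ s hs).2.1, (hθ s hs).2.2.1, ?_⟩
  have := pruefer_angle_lower (by norm_num) hder hs
  rw [← hφ] at this
  norm_num at this ⊢
  linarith

end IsAiryPair

/-- A strictly monotone sequence of values of a strictly increasing enumeration dominates it. -/
theorem enum_le_of_strictMono {f z : ℕ → ℝ} (hf : StrictMono f) (hz : StrictMono z)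
    (h : ∀ i, ∃ k, z i = f k) (j : ℕ) : f j ≤ z j := by
  choose k hk using h
  have hkm : StrictMono k := fun a b hab => by
    have := hz hab
    rwa [hk, hk, hf.lt_iff_lt] at this
  rw [hk]
  exact hf.monotone hkm.le_apply

theorem exists_interlacing_zeros {F : ℝ → ℝ} (hF : Continuous F) {b : ℕ → ℝ} (hb : StrictMono b)
    (hs : ∀ j, 0 < (-1) ^ j * F (b j)) :
    ∃ z : ℕ → ℝ, StrictMono z ∧ ∀ j, b j < z j ∧ z j < b (j + 1) ∧ F (z j) = 0 := by
  have key : ∀ j, ∃ x, b j < x ∧ x < b (j + 1) ∧ F x = 0 := by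
    intro j
    have hc : ContinuousOn (fun x => (-1) ^ j * F x) (Icc (b j) (b (j + 1))) := by fun_prop
    have h2 : (-1) ^ j * F (b (j + 1)) < 0 := by
      have := hs (j + 1)
      rw [pow_succ] at this
      linarith
    obtain ⟨x, hx, hx0⟩ := intermediate_value_Ioo' (hb (Nat.lt_succ_self j)).le hc ⟨h2, hs j⟩
    refine ⟨x, hx.1, hx.2, ?_⟩
    exact (mul_eq_zero.1 hx0).resolve_left (by positivity)
  choose z hz using key
  refine ⟨z, strictMono_nat_of_lt_succ fun j => ?_, hz⟩
  exact (hz j).2.1.trans (hz (j + 1)).1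

theorem cos_nat_add_half_mul_pi (j : ℕ) : cos (((2 * j : ℕ) + 1 : ℝ) * π / 2) = 0 := by
  rw [cos_eq_zero_iff]
  exact ⟨j, by push_cast; ring⟩

theorem sin_nat_add_half_mul_pi (j : ℕ) : sin (((2 * j : ℕ) + 1 : ℝ) * π / 2) = (-1) ^ j := by
  have : ((2 * j : ℕ) + 1 : ℝ) * π / 2 = π / 2 + j * π := by push_cast; ring
  rw [this, sin_add_nat_mul_pi, sin_pi_div_two, mul_one]

namespace IsAiryPair

variable {u v u' v' : ℝ → ℝ}

/-- The zeros of `v'` and `v` on the negative axis, in increasing order and interlaced, with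
upper bounds. -/
theorem exists_zeros (h : IsAiryPair u v u' v') :
    ∃ σ : ℕ → ℝ, StrictMono σ ∧ 0 < σ 0 ∧
      (∀ k, 1 ≤ k → 2 / 3 * σ k ^ 3 ≤ (k / 2 - 1 / 6) * π + 1.898) ∧
      (∀ j : ℕ, v' (-σ (2 * j) ^ 2) = 0 ∧ 0 < (-1) ^ j * u' (-σ (2 * j) ^ 2)) ∧
      ∀ j : ℕ, v (-σ (2 * j + 1) ^ 2) = 0 ∧ 0 < (-1) ^ (j + 1) * u (-σ (2 * j + 1) ^ 2) := by
  obtain ⟨θ, R, hmono, hle, hcont, hθ⟩ := h.exists_angle_v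
  have hpi := pi_gt_d2
  have hex : ∀ k : ℕ, 1 ≤ k → ∃ s, 7/5 ≤ s ∧ θ s = (k + 1) * π / 2 ∧
      2 / 3 * s ^ 3 ≤ (k / 2 - 1 / 6) * π + 1.898 := by
    intro k hk
    have hk' : (1:ℝ) ≤ k := by exact_mod_cast hk
    set X : ℝ := 3 / 2 * ((k / 2 - 1 / 6) * π + 1.898) with hX
    have hX0 : (7/5 : ℝ) ^ 3 ≤ X := by
      rw [hX]
      norm_num
      nlinarith
    have hXpos : 0 ≤ X := le_trans (by norm_num) hX0
    set S : ℝ := X ^ ((1:ℝ)/3) with hS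
    have hS0 : 0 ≤ S := rpow_nonneg hXpos _
    have hS3 : S ^ 3 = X := by
      rw [hS, ← rpow_natCast, ← rpow_mul hXpos]
      norm_num
    have hS1 : 7/5 ≤ S := le_of_pow_le_pow_left₀ three_ne_zero hS0 (by rw [hS3]; exact hX0)
    have h1 : (k + 1) * π / 2 ≤ θ S := by
      have := (hθ S hS1).2.2.2
      rw [hS3, hX] at this
      linarith
    have h2 : θ (7/5) ≤ (k + 1) * π / 2 := by nlinarith
    obtain ⟨s, hs, hsθ⟩ := intermediate_value_Icc hS1
      (hcont.mono Icc_subset_Ici_self) ⟨h2, h1⟩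
    refine ⟨s, hs.1, hsθ, ?_⟩
    have : s ^ 3 ≤ S ^ 3 := pow_le_pow_left₀ (le_trans (by norm_num) hs.1) hs.2 3
    rw [hS3, hX] at this
    linarith
  obtain ⟨e, he, he0⟩ : ∃ e ∈ Ioo (0:ℝ) (7/5), v' (-e ^ 2) = 0 := by
    have hb := (airy_odd_bounds h.hasDerivAt_v_neg h.hasDerivAt_v'_neg
      (by simp [h.v_zero]) (by simp [h.v'_zero]) h.v_neg_nonneg).2.2
    have hc : ContinuousOn (fun s => v' (-s ^ 2)) (Icc 0 (7/5)) := fun s _ =>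
      (hasDerivAt_comp_sq h.hasDerivAt_v'_neg s).continuousAt.continuousWithinAt
    have h49 : (7/5 : ℝ) ^ 2 = 49/25 := by norm_num
    exact intermediate_value_Ioo' (by norm_num) hc
      ⟨by simp only [h49]; norm_num at hb ⊢; linarith, by simp [h.v'_zero]⟩
  choose! s hs1 hs2 hs3 using hex
  have hv' : ∀ j : ℕ, 1 ≤ j → v' (-s (2 * j) ^ 2) = 0 ∧ 0 < (-1) ^ j * u' (-s (2 * j) ^ 2) := by
    intro j hj
    have hk : 1 ≤ 2 * j := by omega
    obtain ⟨hR, hc, hsn, -⟩ := hθ _ (hs1 _ hk)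
    rw [hs2 _ hk, cos_nat_add_half_mul_pi, mul_zero] at hc
    rw [hs2 _ hk, sin_nat_add_half_mul_pi] at hsn
    refine ⟨hc, ?_⟩
    have hw := h.wronskian (-s (2 * j) ^ 2)
    rw [hc] at hw
    have hpos : 0 < s (2 * j) := lt_of_lt_of_le (by norm_num) (hs1 _ hk)
    by_contra! hcon
    have h1 := mul_nonpos_of_nonneg_of_nonpos hR.le hcon
    have h2 : R (s (2 * j)) * ((-1) ^ j * u' (-s (2 * j) ^ 2)) = s (2 * j) := by
      linear_combination -u' (-s (2 * j) ^ 2) * hsn + s (2 * j) * hw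
    linarith
  have hv : ∀ j : ℕ, v (-s (2 * j + 1) ^ 2) = 0 ∧
      0 < (-1) ^ (j + 1) * u (-s (2 * j + 1) ^ 2) := by
    intro j
    have hk : 1 ≤ 2 * j + 1 := by omega
    obtain ⟨hR, hc, hsn, -⟩ := hθ _ (hs1 _ hk)
    have hang : ((2 * j + 1 : ℕ) + 1 : ℝ) * π / 2 = (j + 1 : ℕ) * π := by push_cast; ring
    rw [hs2 _ hk, hang, cos_nat_mul_pi] at hc
    rw [hs2 _ hk, hang, sin_nat_mul_pi, mul_zero] at hsn
    have hpos : 0 < s (2 * j + 1) := lt_of_lt_of_le (by norm_num) (hs1 _ hk)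
    have hv0 := neg_eq_zero.1 ((mul_eq_zero.1 hsn).resolve_left hpos.ne')
    refine ⟨hv0, ?_⟩
    have hw := h.wronskian (-s (2 * j + 1) ^ 2)
    rw [hv0, hc] at hw
    by_contra! hcon
    have h1 := mul_nonpos_of_nonneg_of_nonpos hR.le hcon
    linarith
  refine ⟨fun k => if k = 0 then e else s k, ?_, by simpa using he.1, ?_, ?_, ?_⟩
  · refine strictMono_nat_of_lt_succ fun k => ?_
    rcases Nat.eq_zero_or_pos k with rfl | hk
    · simpa using he.2.trans_le (hs1 1 le_rfl)
    · have hk1 : 1 ≤ k + 1 := by omega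
      simp only [hk.ne', if_false, Nat.succ_ne_zero]
      rw [← hmono.lt_iff_lt (hs1 k hk) (hs1 _ hk1), hs2 k hk, hs2 _ hk1]
      push_cast
      linarith
  · intro k hk
    have : k ≠ 0 := by omega
    simpa [this] using hs3 k hk
  · intro j
    rcases Nat.eq_zero_or_pos j with rfl | hj
    · have := h.u'_neg_pos (t := e ^ 2) (pow_pos he.1 2) (by nlinarith [he.1, he.2])
      simpa using ⟨he0, this⟩
    · have h0 : 2 * j ≠ 0 := by omega
      simpa only [h0, if_false] using hv' j hj
  · intro j
    have h0 : 2 * j + 1 ≠ 0 := by omega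
    simpa only [h0, if_false] using hv j

/-- Lower bound for the zeros of `u` and `u'` on the negative axis. -/
theorem zeros_lower (h : IsAiryPair u v u' v') {tc : ℕ → ℝ} (htcpos : ∀ p, 0 < tc p)
    (htc_even_mono : StrictMono (fun j => tc (2*j)))
    (htc_odd_mono : StrictMono (fun j => tc (2*j+1)))
    (hzu : ∀ x : ℝ, u x = 0 ↔ ∃ j : ℕ, x = -tc (2*j))
    (hzu' : ∀ x : ℝ, x < 0 → (u' x = 0 ↔ ∃ j : ℕ, x = -tc (2*j+1))) (p : ℕ) :
    ∃ s, 0 < s ∧ tc p = s ^ 2 ∧ p / 2 * π + 1.738 ≤ 2 / 3 * s ^ 3 := by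
  obtain ⟨θ, R, hmono, hlo, hθ⟩ := h.exists_angle_u
  have hpi := pi_pos
  have hzu0 : ∀ j, u (-tc (2 * j)) = 0 := fun j => (hzu _).2 ⟨j, rfl⟩
  have hzu'0 : ∀ j, u' (-tc (2 * j + 1)) = 0 := fun j =>
    (hzu' _ (neg_lt_zero.2 (htcpos _))).2 ⟨j, rfl⟩
  have hbig : ∀ p, 49/25 < tc p := by
    intro p
    by_contra! hcon
    rcases Nat.even_or_odd' p with ⟨j, rfl | rfl⟩
    · have := h.u_neg_pos _ ⟨(htcpos (2 * j)).le, hcon⟩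
      rw [hzu0] at this
      exact lt_irrefl _ this
    · have := h.u'_neg_pos (htcpos (2 * j + 1)) hcon
      rw [hzu'0] at this
      exact lt_irrefl _ this
  set r : ℕ → ℝ := fun p => √(tc p) with hr
  have hr2 : ∀ p, r p ^ 2 = tc p := fun p => sq_sqrt (htcpos p).le
  have hr1 : ∀ p, 7/5 < r p := fun p => (lt_sqrt (by norm_num)).2 (by norm_num; linarith [hbig p])
  have hlt : ∀ p q, tc p < tc q → θ (r p) < θ (r q) := fun p q hpq =>
    hmono (hr1 p).le (hr1 q).le (sqrt_lt_sqrt (htcpos p).le hpq)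
  have hstart : ∀ p, π / 2 < θ (r p) := fun p =>
    hlo.trans (hmono (mem_Ici.2 le_rfl) (hr1 p).le (hr1 p))
  have heven : ∀ j : ℕ, ((j:ℝ) + 1) * π ≤ θ (r (2 * j)) := by
    have hint : ∀ j : ℕ, ∃ n : ℤ, n * π = θ (r (2 * j)) := by
      intro j
      obtain ⟨hR, -, hsn, -⟩ := hθ _ (hr1 (2 * j)).le
      rw [hr2, hzu0, mul_zero] at hsn
      exact sin_eq_zero_iff.1 ((mul_eq_zero.1 hsn.symm).resolve_left hR.ne')
    choose n hn using hint
    have hnj : ∀ j : ℕ, (j:ℤ) + 1 ≤ n j := by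
      intro j
      induction j with
      | zero =>
        have h1 := hstart (2 * 0)
        rw [← hn] at h1
        have : (0:ℝ) < n 0 := by nlinarith
        have : 0 < n 0 := by exact_mod_cast this
        simp only [Nat.cast_zero, zero_add]
        omega
      | succ j ih =>
        have h1 := hlt _ _ (htc_even_mono (Nat.lt_succ_self j))
        rw [← hn, ← hn] at h1
        have : (n j : ℝ) < n (j + 1) := lt_of_mul_lt_mul_right h1 hpi.le
        have : n j < n (j + 1) := by exact_mod_cast this
        push_cast
        omega
    intro j
    rw [← hn]
    have : ((j:ℝ) + 1) ≤ n j := by exact_mod_cast hnj j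
    exact mul_le_mul_of_nonneg_right this hpi.le
  have hodd : ∀ j : ℕ, ((j:ℝ) + 1) * π + π / 2 ≤ θ (r (2 * j + 1)) := by
    have hint : ∀ j : ℕ, ∃ n : ℤ, θ (r (2 * j + 1)) = (2 * n + 1) * π / 2 := by
      intro j
      obtain ⟨hR, hc, -, -⟩ := hθ _ (hr1 (2 * j + 1)).le
      rw [hr2, hzu'0, neg_zero] at hc
      exact cos_eq_zero_iff.1 ((mul_eq_zero.1 hc.symm).resolve_left hR.ne')
    choose n hn using hint
    have hnj : ∀ j : ℕ, (j:ℤ) + 1 ≤ n j := by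
      intro j
      induction j with
      | zero =>
        have h1 := hstart (2 * 0 + 1)
        rw [hn] at h1
        have : (0:ℝ) < n 0 := by nlinarith
        have : 0 < n 0 := by exact_mod_cast this
        simp only [Nat.cast_zero, zero_add]
        omega
      | succ j ih =>
        have h1 := hlt _ _ (htc_odd_mono (Nat.lt_succ_self j))
        rw [hn, hn] at h1
        have : (n j : ℝ) < n (j + 1) := by nlinarith
        have : n j < n (j + 1) := by exact_mod_cast this
        push_cast
        omega
    intro j
    rw [hn]
    have : ((j:ℝ) + 1) ≤ n j := by exact_mod_cast hnj j
    nlinarith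
  refine ⟨r p, lt_trans (by norm_num) (hr1 p), (hr2 p).symm, ?_⟩
  have hup := (hθ _ (hr1 p).le).2.2.2
  rcases Nat.even_or_odd' p with ⟨j, rfl | rfl⟩
  · have := heven j
    push_cast
    linarith
  · have := hodd j
    push_cast
    linarith

end IsAiryPair

theorem enum_zeros_v_le {v v' : ℝ → ℝ} {cc σ : ℕ → ℝ}
    (hcc_even_mono : StrictMono (fun j => cc (2*j)))
    (hcc_odd_mono : StrictMono (fun j => cc (2*j+1)))
    (hzv' : ∀ x : ℝ, v' x = 0 ↔ ∃ j : ℕ, x = -cc (2*j))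
    (hzv : ∀ x : ℝ, x < 0 → (v x = 0 ↔ ∃ j : ℕ, x = -cc (2*j+1)))
    (hσ : StrictMono σ) (hσ0 : 0 < σ 0) (h0 : ∀ j : ℕ, v' (-σ (2 * j) ^ 2) = 0)
    (h1 : ∀ j : ℕ, v (-σ (2 * j + 1) ^ 2) = 0) (p : ℕ) : cc p ≤ σ p ^ 2 := by
  have hpos : ∀ k, 0 < σ k := fun k => hσ0.trans_le (hσ.monotone (Nat.zero_le k))
  have hsq : ∀ {k l}, k < l → σ k ^ 2 < σ l ^ 2 := fun {k l} hkl =>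
    pow_lt_pow_left₀ (hσ hkl) (hpos k).le two_ne_zero
  rcases Nat.even_or_odd' p with ⟨j, rfl | rfl⟩
  · refine enum_le_of_strictMono (z := fun j => σ (2 * j) ^ 2) hcc_even_mono
      (fun a b hab => hsq (by omega)) (fun i => ?_) j
    obtain ⟨k, hk⟩ := (hzv' _).1 (h0 i)
    exact ⟨k, neg_injective hk⟩
  · refine enum_le_of_strictMono (z := fun j => σ (2 * j + 1) ^ 2) hcc_odd_mono
      (fun a b hab => hsq (by omega)) (fun i => ?_) j
    obtain ⟨k, hk⟩ := (hzv _ (neg_lt_zero.2 (pow_pos (hpos _) 2))).1 (h1 i)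
    exact ⟨k, neg_injective hk⟩

theorem enum_lt_of_sign_changes {F : ℝ → ℝ} (hF : Continuous F) {f b : ℕ → ℝ}
    (hf : StrictMonoOn f (Ici 1)) (hz : ∀ x, F x = 0 → ∃ k, 1 ≤ k ∧ x = f k) (hb : StrictMono b)
    (hs : ∀ j, 0 < (-1) ^ j * F (b j)) (j : ℕ) : f (j + 1) < b (j + 1) := by
  obtain ⟨z, hzm, hzb⟩ := exists_interlacing_zeros hF hb hs
  refine lt_of_le_of_lt (enum_le_of_strictMono (f := fun j => f (j + 1)) ?_ hzm ?_ j) (hzb j).2.1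
  · exact fun a b hab => hf (by simp) (by simp) (by omega)
  · intro i
    obtain ⟨k, hk, hzk⟩ := hz _ (hzb i).2.2
    exact ⟨k - 1, by rw [hzk, Nat.sub_add_cancel hk]⟩

theorem IsAiryPair.frak_lt {u v u' v' : ℝ → ℝ} (h : IsAiryPair u v u' v') {a ta σ : ℕ → ℝ}
    (hamono : StrictMonoOn a (Ici 1)) (htamono : StrictMonoOn ta (Ici 1))
    (hzAi : ∀ x : ℝ, AiF u v x = 0 ↔ ∃ k, 1 ≤ k ∧ x = -a k)
    (hzAi' : ∀ x : ℝ, AiD u' v' x = 0 ↔ ∃ k, 1 ≤ k ∧ x = -ta k)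
    (hσ : StrictMono σ) (hσ0 : 0 < σ 0)
    (h0 : ∀ j : ℕ, v' (-σ (2 * j) ^ 2) = 0 ∧ 0 < (-1) ^ j * u' (-σ (2 * j) ^ 2))
    (h1 : ∀ j : ℕ, v (-σ (2 * j + 1) ^ 2) = 0 ∧ 0 < (-1) ^ (j + 1) * u (-σ (2 * j + 1) ^ 2))
    (p : ℕ) : frak a ta p < σ p ^ 2 := by
  have hpos : ∀ k, 0 < σ k := fun k => hσ0.trans_le (hσ.monotone (Nat.zero_le k))
  have hsq : ∀ {k l}, k < l → σ k ^ 2 < σ l ^ 2 := fun {k l} hkl =>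
    pow_lt_pow_left₀ (hσ hkl) (hpos k).le two_ne_zero
  have hα : 0 < (3:ℝ) ^ ((2:ℝ)/3) * Real.Gamma (2/3) :=
    mul_pos (by positivity) (Real.Gamma_pos_of_pos (by norm_num))
  have hcu : Continuous u := continuous_iff_continuousAt.2 fun t => (h.hu t).continuousAt
  have hcv : Continuous v := continuous_iff_continuousAt.2 fun t => (h.hv t).continuousAt
  have hcu' : Continuous u' := continuous_iff_continuousAt.2 fun t => (h.hu' t).continuousAt
  have hcv' : Continuous v' := continuous_iff_continuousAt.2 fun t => (h.hv' t).continuousAt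
  rcases Nat.even_or_odd' p with ⟨j, rfl | rfl⟩
  · have hfr : frak a ta (2 * j) = ta (j + 1) := by simp [frak]
    rw [hfr]
    refine enum_lt_of_sign_changes (F := fun t => -AiD u' v' (-t))
      (b := fun i => if i = 0 then 0 else σ (2 * (i - 1)) ^ 2) (by unfold AiD; fun_prop) htamono
      ?_ (strictMono_nat_of_lt_succ ?_) ?_ j
    · intro x hx
      obtain ⟨k, hk, hxk⟩ := (hzAi' _).1 (neg_eq_zero.1 hx)
      exact ⟨k, hk, neg_injective hxk⟩
    · intro i
      rcases i with _ | i
      · simpa using pow_pos (hpos 0) 2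
      · simpa using hsq (by omega : 2 * i < 2 * (i + 1))
    · intro i
      rcases i with _ | i
      · simpa [AiD, h.u'_zero, h.v'_zero] using
          mul_pos (inv_pos.2 (Real.Gamma_pos_of_pos (by norm_num : (0:ℝ) < 3⁻¹)))
            (inv_pos.2 (by positivity : (0:ℝ) < 3 ^ ((3:ℝ)⁻¹)))
      · have := div_pos (h0 i).2 hα
        simp only [AiD, Nat.succ_ne_zero, if_false, Nat.add_sub_cancel, (h0 i).1]
        refine this.trans_eq ?_
        rw [pow_succ]
        ring
  · have hfr : frak a ta (2 * j + 1) = a (j + 1) := by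
      have e2 : (2 * j + 1) / 2 = j := by omega
      simp [frak, e2]
    rw [hfr]
    refine enum_lt_of_sign_changes (F := fun t => AiF u v (-t))
      (b := fun i => if i = 0 then 0 else σ (2 * (i - 1) + 1) ^ 2) (by unfold AiF; fun_prop)
      hamono ?_ (strictMono_nat_of_lt_succ ?_) ?_ j
    · intro x hx
      obtain ⟨k, hk, hxk⟩ := (hzAi _).1 hx
      exact ⟨k, hk, neg_injective hxk⟩
    · intro i
      rcases i with _ | i
      · simpa using pow_pos (hpos 1) 2
      · simpa using hsq (by omega : 2 * i + 1 < 2 * (i + 1) + 1)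
    · intro i
      rcases i with _ | i
      · simp only [AiF, if_true, neg_zero, h.u_zero, h.v_zero]
        simpa only [pow_zero, one_mul, zero_div, sub_zero] using one_div_pos.2 hα
      · have := div_pos (h1 i).2 hα
        simp only [AiF, Nat.succ_ne_zero, if_false, Nat.add_sub_cancel, (h1 i).1]
        refine this.trans_eq ?_
        ring

/-- Tangent line bound for `ξ ↦ t`, where `t = s²` and `ξ = 2/3 s³`. -/
theorem sq_sub_sq_le {r s : ℝ} (hr : 0 < r) (hs : 0 < s) :
    s ^ 2 - r ^ 2 ≤ (2 / 3 * s ^ 3 - 2 / 3 * r ^ 3) / r := by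
  rw [le_div_iff₀ hr]
  nlinarith [mul_nonneg (sq_nonneg (s - r)) (by positivity : 0 ≤ 2 * s + r)]

theorem rpow_third_pow {x : ℝ} (hx : 0 ≤ x) : (x ^ ((1:ℝ)/3)) ^ 3 = x := by
  rw [← rpow_natCast, ← rpow_mul hx]
  norm_num

theorem rpow_neg_third {x : ℝ} (hx : 0 ≤ x) : x ^ (-(1:ℝ)/3) = (x ^ ((1:ℝ)/3))⁻¹ := by
  rw [← rpow_neg hx]
  norm_num

theorem Ifun_bound : Ifun (((7:ℝ)/6) ^ ((2:ℝ)/3)) * ((2:ℝ) ^ ((1:ℝ)/3) * π ^ ((2:ℝ)/3) / 9) ≤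
    13 / 162 * π * ((3:ℝ)/π) ^ ((1:ℝ)/3) := by
  have hpi := pi_pos
  set y : ℝ := ((7:ℝ)/6) ^ ((2:ℝ)/3) with hy
  have hy1 : 1 ≤ y := one_le_rpow (by norm_num) (by norm_num)
  have hy32 : y ^ ((3:ℝ)/2) = 7/6 := by
    rw [hy, ← rpow_mul (by norm_num)]
    norm_num
  have hI : Ifun y ≤ ((3:ℝ)/2) ^ ((1:ℝ)/3) * (13/18) := by
    unfold Ifun
    rw [hy32, div_le_iff₀ (by positivity)]
    have hk : 0 < ((3:ℝ)/2) ^ ((1:ℝ)/3) := by positivity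
    have : (13/6 : ℝ) ≤ 13/18 * (y ^ 2 + y + 1) := by nlinarith
    nlinarith [mul_le_mul_of_nonneg_left this hk.le]
  have e : ((3:ℝ)/2) ^ ((1:ℝ)/3) * ((2:ℝ) ^ ((1:ℝ)/3) * π ^ ((2:ℝ)/3)) =
      π * ((3:ℝ)/π) ^ ((1:ℝ)/3) := by
    rw [div_rpow (by norm_num) (by norm_num), div_rpow (by norm_num) hpi.le]
    have h1 : π ^ ((2:ℝ)/3) * π ^ ((1:ℝ)/3) = π := by
      rw [← rpow_add hpi]
      norm_num
    have h2 : (2:ℝ) ^ ((1:ℝ)/3) ≠ 0 := by positivity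
    have h3 : π ^ ((1:ℝ)/3) ≠ 0 := by positivity
    field_simp
    linear_combination h1
  calc _ ≤ ((3:ℝ)/2) ^ ((1:ℝ)/3) * (13/18) * ((2:ℝ) ^ ((1:ℝ)/3) * π ^ ((2:ℝ)/3) / 9) := by
        gcongr
    _ = _ := by linear_combination (13/162) * e

/-- Upper bound for the difference of the squares when the cubes are spaced by `D` and bounded below. -/
theorem sq_sub_sq_le_of_cube {q r s D : ℝ} (hq : 0 < q) (hr : 0 < r) (hs : 0 < s)
    (hr3 : q ^ 3 * π / 2 ≤ 2 / 3 * r ^ 3) (hD : 2 / 3 * s ^ 3 - 2 / 3 * r ^ 3 ≤ D) (hD0 : 0 ≤ D) :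
    s ^ 2 - r ^ 2 ≤ D / 1.31 * ((3:ℝ)/π) ^ ((1:ℝ)/3) / q := by
  have hpi := pi_pos
  set k := ((3:ℝ)/π) ^ ((1:ℝ)/3) with hk
  have hk0 : 0 < k := by positivity
  have hk3 : k ^ 3 = 3 / π := rpow_third_pow (by positivity)
  have hlow : 1.31 * q / k ≤ r := by
    refine le_of_pow_le_pow_left₀ three_ne_zero hr.le ?_
    rw [div_pow, hk3, div_le_iff₀ (by positivity)]
    have h1 : r ^ 3 * (3 / π) * π = 3 * r ^ 3 := by field_simp
    have h2 : (1.31 * q) ^ 3 ≤ 9 / 4 * q ^ 3 := by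
      have : 0 < q ^ 3 := by positivity
      nlinarith
    have h3 : 9 / 4 * q ^ 3 * π ≤ r ^ 3 * (3 / π) * π := by rw [h1]; linarith
    exact h2.trans (le_of_mul_le_mul_right h3 hpi)
  calc s ^ 2 - r ^ 2 ≤ (2 / 3 * s ^ 3 - 2 / 3 * r ^ 3) / r := sq_sub_sq_le hr hs
    _ ≤ D / r := by gcongr
    _ ≤ D / (1.31 * q / k) := by gcongr
    _ = _ := by field_simp

/-- Lower bound for the difference of the squares when the cubes are spaced by `D`. -/
theorem le_sq_sub_sq_of_cube {q r s X D : ℝ} (hq : 0 < q) (hr : 0 < r) (hs : 0 < s) (hX : 0 < X)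
    (hXs : X ≤ 2 / 3 * s ^ 3) (hXq : X ≤ 1.038 * (q ^ 3 * π / 2)) (hD : 0 < D)
    (hXr : D ≤ X - 2 / 3 * r ^ 3) :
    D / 1.327 * ((3:ℝ)/π) ^ ((1:ℝ)/3) / q ≤ s ^ 2 - r ^ 2 := by
  have hpi := pi_pos
  set k := ((3:ℝ)/π) ^ ((1:ℝ)/3) with hk
  have hk0 : 0 < k := by positivity
  have hk3 : k ^ 3 = 3 / π := rpow_third_pow (by positivity)
  set S : ℝ := (3 / 2 * X) ^ ((1:ℝ)/3) with hS
  have hS0 : 0 < S := by positivity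
  have hS3 : S ^ 3 = 3 / 2 * X := rpow_third_pow (by positivity)
  have hSs : S ≤ s := le_of_pow_le_pow_left₀ three_ne_zero hs.le (by rw [hS3]; linarith)
  have hup : S ≤ 1.327 * q / k := by
    refine le_of_pow_le_pow_left₀ three_ne_zero (by positivity) ?_
    rw [div_pow, hk3, hS3, le_div_iff₀ (by positivity)]
    have h1 : 3 / 2 * X * (3 / π) ≤ 3 / 2 * (1.038 * (q ^ 3 * π / 2)) * (3 / π) := by gcongr
    have h2 : 3 / 2 * (1.038 * (q ^ 3 * π / 2)) * (3 / π) = 3 / 2 * 1.038 * 3 / 2 * q ^ 3 := by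
      field_simp
    have h3 : 0 < q ^ 3 := by positivity
    nlinarith
  have h1 := sq_sub_sq_le hS0 hr
  rw [hS3] at h1
  have h2 : D / S ≤ (2 / 3 * (3 / 2 * X) - 2 / 3 * r ^ 3) / S := by
    gcongr
    linarith
  have h3 : D / (1.327 * q / k) ≤ D / S := by gcongr
  have h4 : S ^ 2 ≤ s ^ 2 := by gcongr
  have h5 : D / (1.327 * q / k) = D / 1.327 * k / q := by field_simp
  have h6 : (2 / 3 * (3 / 2 * X) - 2 / 3 * r ^ 3) / S =
    -((2 / 3 * r ^ 3 - 2 / 3 * (3 / 2 * X)) / S) := by ring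
  linarith

set_option maxHeartbeats 800000 in
theorem stmt_15 (u v u' v' : ℝ → ℝ)
    (hu : ∀ x, HasDerivAt u (u' x) x)
    (huAiry : ∀ x, HasDerivAt u' (x * u x) x)
    (hv : ∀ x, HasDerivAt v (v' x) x)
    (hvAiry : ∀ x, HasDerivAt v' (x * v x) x)
    (hu0 : u 0 = 1) (hu'0 : u' 0 = 0) (hv0 : v 0 = 0) (hv'0 : v' 0 = 1)
    (a ta : ℕ → ℝ) (cc tc : ℕ → ℝ)
    (hapos : ∀ k, 1 ≤ k → 0 < a k) (htapos : ∀ k, 1 ≤ k → 0 < ta k)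
    (hamono : StrictMonoOn a (Ici 1)) (htamono : StrictMonoOn ta (Ici 1))
    (hccpos : ∀ p, 0 < cc p) (htcpos : ∀ p, 0 < tc p)
    (hcc_even_mono : StrictMono (fun j => cc (2*j)))
    (hcc_odd_mono : StrictMono (fun j => cc (2*j+1)))
    (htc_even_mono : StrictMono (fun j => tc (2*j)))
    (htc_odd_mono : StrictMono (fun j => tc (2*j+1)))
    (hzAi : ∀ x : ℝ, AiF u v x = 0 ↔ ∃ k, 1 ≤ k ∧ x = -a k)
    (hzAi' : ∀ x : ℝ, AiD u' v' x = 0 ↔ ∃ k, 1 ≤ k ∧ x = -ta k)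
    (hzv' : ∀ x : ℝ, v' x = 0 ↔ ∃ j : ℕ, x = -cc (2*j))
    (hzv : ∀ x : ℝ, x < 0 → (v x = 0 ↔ ∃ j : ℕ, x = -cc (2*j+1)))
    (hzu : ∀ x : ℝ, u x = 0 ↔ ∃ j : ℕ, x = -tc (2*j))
    (hzu' : ∀ x : ℝ, x < 0 → (u' x = 0 ↔ ∃ j : ℕ, x = -tc (2*j+1)))
    (p : ℕ) (hp : 2 ≤ p) (c : ℝ) (hc : 0 < c)
    (Em Ep Em' : ℝ)
    (hEmle : Em ≤ 0) (hEple : Ep ≤ 0) (hEm'le : Em' ≤ 0)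
    -- lower edge E_p^- of the p-th band
    (hEm_mem : -c - Em ∈ Ioc (-(frak a ta p)) (-(tc (p - 1))))
    (hEm_eq_even : Even p →
      u' (-c - Em) * v' (-Em) = v' (-c - Em) * u' (-Em))
    (hEm_eq_odd : ¬ Even p →
      v' (-Em) * u (-c - Em) = u' (-Em) * v (-c - Em))
    -- upper edge E_p^+ of the p-th band
    (hEp_mem : -c - Ep ∈ Ico (-(cc p)) (-(frak a ta p)))
    (hEp_eq_even : Even p →
      v (-Ep) * u' (-c - Ep) = u (-Ep) * v' (-c - Ep))
    (hEp_eq_odd : ¬ Even p →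
      u (-Ep) * v (-c - Ep) = v (-Ep) * u (-c - Ep))
    -- lower edge E_{p+1}^- of the (p+1)-th band
    (hEm'_mem : -c - Em' ∈ Ioc (-(frak a ta (p+1))) (-(tc p)))
    (hEm'_eq_even : Even (p+1) →
      u' (-c - Em') * v' (-Em') = v' (-c - Em') * u' (-Em'))
    (hEm'_eq_odd : ¬ Even (p+1) →
      v' (-Em') * u (-c - Em') = u' (-Em') * v (-c - Em')) :
    -- band width estimate
    (0 < Ep - Em ∧
      Ep - Em ≤ (π/3 + 7/(3*π) * ((p:ℝ) + 1/3) / ((p:ℝ) * ((p:ℝ) + 2/3)))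
        * ((3:ℝ)/π) ^ ((1:ℝ)/3) * (p:ℝ) ^ (-(1:ℝ)/3)) ∧
    -- gap width estimates (gaps are open)
    (Ifun (((7:ℝ)/6) ^ ((2:ℝ)/3)) * ((2:ℝ) ^ ((1:ℝ)/3) * π ^ ((2:ℝ)/3) / 9)
        * ((p:ℝ) + 1) ^ (-(1:ℝ)/3) < Em' - Ep ∧
      Em' - Ep ≤ (π + 7/(3*π) * (p:ℝ) / ((p:ℝ) ^ 2 - 1))
        * ((3:ℝ)/π) ^ ((1:ℝ)/3) * ((p:ℝ) - 1) ^ (-(1:ℝ)/3)) := by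
  have h : IsAiryPair u v u' v' := ⟨hu, huAiry, hv, hvAiry, hu0, hu'0, hv0, hv'0⟩
  obtain ⟨σ, hσ, hσ0, hσup, h0, h1⟩ := h.exists_zeros
  have hcc := enum_zeros_v_le hcc_even_mono hcc_odd_mono hzv' hzv hσ hσ0
    (fun j => (h0 j).1) (fun j => (h1 j).1) p
  have hfrak := h.frak_lt hamono htamono hzAi hzAi' hσ hσ0 h0 h1 (p + 1)
  obtain ⟨s1, hs1, hts1, hs1lo⟩ :=
    h.zeros_lower htcpos htc_even_mono htc_odd_mono hzu hzu' (p - 1)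
  obtain ⟨s2, hs2, hts2, hs2lo⟩ := h.zeros_lower htcpos htc_even_mono htc_odd_mono hzu hzu' p
  have hpos : ∀ k, 0 < σ k := fun k => hσ0.trans_le (hσ.monotone (Nat.zero_le k))
  have hσp := hσup p (by omega)
  have hσp1 := hσup (p + 1) (by omega)
  obtain ⟨hEm1, hEm2⟩ := hEm_mem
  obtain ⟨hEp1, hEp2⟩ := hEp_mem
  obtain ⟨hEm'1, hEm'2⟩ := hEm'_mem
  have hp2 : (2:ℝ) ≤ p := by exact_mod_cast hp
  rw [hts1] at hEm2
  rw [hts2] at hEm'2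
  rw [Nat.cast_sub (by omega), Nat.cast_one] at hs1lo
  push_cast at hσp1
  have hpi := pi_pos
  have hpi1 := pi_gt_d2
  have hpi2 := pi_lt_d2
  set P : ℝ := (p:ℝ) with hP
  set k : ℝ := ((3:ℝ)/π) ^ ((1:ℝ)/3) with hk
  have hk0 : 0 < k := by positivity
  have hq0 : 0 < P ^ ((1:ℝ)/3) := rpow_pos_of_pos (by linarith) _
  have hq3 : (P ^ ((1:ℝ)/3)) ^ 3 = P := rpow_third_pow (by linarith)
  have hr3 : (P ^ ((1:ℝ)/3)) ^ 3 * π / 2 ≤ 2 / 3 * s1 ^ 3 := by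
    rw [hq3]
    linarith
  refine ⟨⟨by linarith, ?_⟩, ?_, ?_⟩
  · have hw := sq_sub_sq_le_of_cube (D := π / 3 + 0.16) hq0 hs1 (hpos p) hr3 (by linarith)
      (by positivity)
    rw [rpow_neg_third (by linarith), ← div_eq_mul_inv]
    have hc0 : 0 ≤ 7 / (3 * π) * (P + 1 / 3) / (P * (P + 2 / 3)) := by positivity
    have hD : (π / 3 + 0.16) / 1.31 ≤ π / 3 := by
      rw [div_le_iff₀ (by norm_num)]
      linarith
    calc Ep - Em ≤ σ p ^ 2 - s1 ^ 2 := by linarith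
      _ ≤ _ := hw
      _ ≤ _ := by
        gcongr
        linarith
  · have hQ0 : 0 < (P + 1) ^ ((1:ℝ)/3) := rpow_pos_of_pos (by linarith) _
    have hQ3 : ((P + 1) ^ ((1:ℝ)/3)) ^ 3 = P + 1 := rpow_third_pow (by linarith)
    have hl := le_sq_sub_sq_of_cube (X := P / 2 * π + 1.738) (D := π / 6 - 0.16) hQ0 (hpos p) hs2
      (by positivity) hs2lo (by rw [hQ3]; nlinarith) (by linarith) (by linarith)
    rw [rpow_neg_third (by linarith), ← div_eq_mul_inv]
    have hD : 13 / 162 * π < (π / 6 - 0.16) / 1.327 := by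
      rw [lt_div_iff₀ (by norm_num)]
      linarith
    calc _ ≤ 13 / 162 * π * k / (P + 1) ^ ((1:ℝ)/3) := by
          exact div_le_div_of_nonneg_right Ifun_bound hQ0.le
      _ < (π / 6 - 0.16) / 1.327 * k / (P + 1) ^ ((1:ℝ)/3) := by
          gcongr
      _ ≤ _ := hl
      _ ≤ Em' - Ep := by linarith
  · have hw := sq_sub_sq_le_of_cube (D := 5 * π / 6 + 0.16) hq0 hs1 (hpos (p + 1)) hr3
      (by linarith) (by positivity)
    have hQ0 : 0 < (P - 1) ^ ((1:ℝ)/3) := rpow_pos_of_pos (by linarith) _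
    have hQ : (P - 1) ^ ((1:ℝ)/3) ≤ P ^ ((1:ℝ)/3) :=
      rpow_le_rpow (by linarith) (by linarith) (by norm_num)
    rw [rpow_neg_third (by linarith), ← div_eq_mul_inv]
    have hc0 : 0 ≤ 7 / (3 * π) * P / (P ^ 2 - 1) :=
      div_nonneg (by positivity) (by nlinarith)
    have hD : (5 * π / 6 + 0.16) / 1.31 ≤ π := by
      rw [div_le_iff₀ (by norm_num)]
      linarith
    calc Em' - Ep ≤ σ (p + 1) ^ 2 - s1 ^ 2 := by linarith
      _ ≤ _ := hw
      _ ≤ _ := div_le_div₀ (mul_nonneg (by linarith) hk0.le)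
        (mul_le_mul_of_nonneg_right (by linarith) hk0.le) hQ0 hQ
end

section
/- (Even bands) For every j ≥ 0 there exists C > 0 such that for every h in (0, c_{2j}^(−3/2)), setting c = h^(−2/3) and writing c̃_{−1} = 0: if E₁ ≤ 0 satisfies −ã_{j+1} < −c − E₁ ≤ −c̃_{2j−1} and u'(−c−E₁)v'(−E₁) = v'(−c−E₁)u'(−E₁), and E₂ ≤ 0 satisfies −c_{2j} ≤ −c − E₂ < −ã_{j+1} and v(−E₂)u'(−c−E₂) = u(−E₂)v'(−c−E₂), then |(E₂ − E₁) − 2·√3·α·(u'(−ã_{j+1}))²/ã_{j+1} · exp(−4/(3h) + 2·ã_{j+1}·h^(−1/3))| ≤ C·h^(1/3)·exp(−4/(3h) + 2·ã_{j+1}·h^(−1/3)). (Odd bands) For every j ≥ 0 there exists C > 0 such that for every h in (0, c_{2j+1}^(−3/2)), setting c = h^(−2/3): if E₁ ≤ 0 satisfies −a_{j+1} < −c − E₁ ≤ −c̃_{2j} and v'(−E₁)u(−c−E₁) = u'(−E₁)v(−c−E₁), and E₂ ≤ 0 satisfies −c_{2j+1} ≤ −c − E₂ < −a_{j+1} and u(−E₂)v(−c−E₂)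 = v(−E₂)u(−c−E₂), then |(E₂ − E₁) − 2·√3·α·(u(−a_{j+1}))² · exp(−4/(3h) + 2·a_{j+1}·h^(−1/3))| ≤ C·h^(1/3)·exp(−4/(3h) + 2·a_{j+1}·h^(−1/3)). (E₂ − E₁ is the width δ_p of the p-th rescaled spectral band, p = 2j or p = 2j+1.) -/
open Real Set

/-- `α = Γ(1/3)/(3^(1/3)·Γ(2/3)) = −Ai(0)/Ai'(0)`. -/
noncomputable def airyAlpha : ℝ :=
  Real.Gamma (1/3) / ((3:ℝ) ^ ((1:ℝ)/3) * Real.Gamma (2/3))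


/-- `∫₀^∞ rⁿ exp(-r³/3 + z r) dr`. -/
noncomputable def cubicMoment (n : ℕ) (z : ℂ) : ℂ :=
  ∫ r in Ioi (0:ℝ), (r:ℂ) ^ n * Complex.exp (-(r:ℂ) ^ 3 / 3 + z * r)

theorem neg_cube_div_three_add_mul_le (b : ℝ) {r : ℝ} (hr : 0 ≤ r) :
    -r ^ 3 / 3 + b * r ≤ (4 / 3 + (b + 1) ^ 2 / 4) + -r := by
  nlinarith [mul_nonneg (sq_nonneg (r - 2)) (by linarith : (0:ℝ) ≤ r + 1), sq_nonneg (r - (b + 1) / 2)]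

theorem norm_cubicMoment_integrand (n : ℕ) (z : ℂ) {r : ℝ} (hr : 0 ≤ r) :
    ‖(r:ℂ) ^ n * Complex.exp (-(r:ℂ) ^ 3 / 3 + z * r)‖ = r ^ n * exp (-r ^ 3 / 3 + z.re * r) := by
  rw [norm_mul, norm_pow, Complex.norm_real, Complex.norm_exp, norm_of_nonneg hr]
  congr 2
  have : (-(r:ℂ) ^ 3 / 3 + z * r) = ((-r ^ 3 / 3 : ℝ) : ℂ) + z * r := by push_cast; ring
  rw [this, Complex.add_re, Complex.ofReal_re, Complex.re_mul_ofReal]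

theorem integrableOn_pow_mul_exp_neg_add (n : ℕ) (K : ℝ) :
    MeasureTheory.IntegrableOn (fun r : ℝ => r ^ n * exp (K + -r)) (Ioi 0) := by
  have h := (Real.GammaIntegral_convergent (s := n + 1) (by positivity)).const_mul (exp K)
  refine MeasureTheory.IntegrableOn.congr_fun h (fun r hr => ?_) measurableSet_Ioi
  simp only [add_sub_cancel_right, rpow_natCast, exp_add]
  ring

theorem continuous_cubicMoment_integrand (n : ℕ) (z : ℂ) :
    Continuous fun r : ℝ => (r:ℂ) ^ n * Complex.exp (-(r:ℂ) ^ 3 / 3 + z * r) := by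
  fun_prop

theorem norm_cubicMoment_integrand_le (n : ℕ) {z : ℂ} {b r : ℝ} (hz : z.re ≤ b) (hr : 0 ≤ r) :
    ‖(r:ℂ) ^ n * Complex.exp (-(r:ℂ) ^ 3 / 3 + z * r)‖
      ≤ r ^ n * exp ((4 / 3 + (b + 1) ^ 2 / 4) + -r) := by
  rw [norm_cubicMoment_integrand n z hr]
  refine mul_le_mul_of_nonneg_left (exp_le_exp.2 ?_) (pow_nonneg hr n)
  refine le_trans ?_ (neg_cube_div_three_add_mul_le b hr)
  gcongr

theorem integrableOn_cubicMoment (n : ℕ) (z : ℂ) : MeasureTheory.IntegrableOn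
    (fun r : ℝ => (r:ℂ) ^ n * Complex.exp (-(r:ℂ) ^ 3 / 3 + z * r)) (Ioi 0) := by
  refine (integrableOn_pow_mul_exp_neg_add n (4 / 3 + (z.re + 1) ^ 2 / 4)).mono'
    (continuous_cubicMoment_integrand n z).aestronglyMeasurable ?_
  refine (MeasureTheory.ae_restrict_iff' measurableSet_Ioi).2 (.of_forall fun r hr => ?_)
  exact norm_cubicMoment_integrand_le n le_rfl (le_of_lt hr)

theorem hasDerivAt_cubicMoment (n : ℕ) (z : ℂ) :
    HasDerivAt (cubicMoment n) (cubicMoment (n + 1) z) z := by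
  refine (hasDerivAt_integral_of_dominated_loc_of_deriv_le (Metric.ball_mem_nhds z one_pos)
    (bound := fun r => r ^ (n + 1) * exp ((4 / 3 + (z.re + 1 + 1) ^ 2 / 4) + -r))
    (F' := fun z r => (r:ℂ) ^ (n + 1) * Complex.exp (-(r:ℂ) ^ 3 / 3 + z * r))
    (.of_forall fun w => (continuous_cubicMoment_integrand n w).aestronglyMeasurable)
    (integrableOn_cubicMoment n z)
    (continuous_cubicMoment_integrand (n + 1) z).aestronglyMeasurable ?_
    (integrableOn_pow_mul_exp_neg_add (n + 1) _) (.of_forall fun r w _ => ?_)).2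
  · refine (MeasureTheory.ae_restrict_iff' measurableSet_Ioi).2 (.of_forall fun r hr w hw => ?_)
    refine norm_cubicMoment_integrand_le (n + 1) ?_ (le_of_lt hr)
    have h1 : |(w - z).re| < 1 := (Complex.abs_re_le_norm _).trans_lt (by simpa [dist_eq_norm] using hw)
    rw [Complex.sub_re] at h1
    linarith [(abs_lt.1 h1).2]
  · have h := ((((hasDerivAt_id w).mul_const (r:ℂ)).const_add (-(r:ℂ) ^ 3 / 3)).cexp).const_mul ((r:ℂ) ^ n)
    refine h.congr_deriv ?_
    simp only [id]
    ring

theorem cubicMoment_two (z : ℂ) : cubicMoment 2 z = 1 + z * cubicMoment 0 z := by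
  have hderiv : ∀ r : ℝ, HasDerivAt (fun r : ℝ => -Complex.exp (-(r:ℂ) ^ 3 / 3 + z * r))
      ((r:ℂ) ^ 2 * Complex.exp (-(r:ℂ) ^ 3 / 3 + z * r)
        - z * ((r:ℂ) ^ 0 * Complex.exp (-(r:ℂ) ^ 3 / 3 + z * r))) r := by
    intro r
    have h0 : HasDerivAt (fun w : ℂ => -Complex.exp (-w ^ 3 / 3 + z * w))
        (-(Complex.exp (-(r:ℂ) ^ 3 / 3 + z * r) * (-(3 * (r:ℂ) ^ 2 * 1) / 3 + z * 1))) (r:ℂ) := by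
      have := (((((hasDerivAt_id (r:ℂ)).pow 3).neg).div_const 3).add
        ((hasDerivAt_id (r:ℂ)).const_mul z)).cexp.neg
      simpa using! this
    refine h0.comp_ofReal.congr_deriv ?_
    ring
  have hlim : Filter.Tendsto (fun r : ℝ => -Complex.exp (-(r:ℂ) ^ 3 / 3 + z * r))
      Filter.atTop (nhds 0) := by
    refine squeeze_zero_norm' (a := fun r => exp ((4 / 3 + (z.re + 1) ^ 2 / 4) + -r)) ?_ ?_
    · filter_upwards [Filter.eventually_ge_atTop 0] with r hr
      have := norm_cubicMoment_integrand_le 0 (le_refl z.re) hr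
      simpa using this
    · exact tendsto_exp_atBot.comp
        (Filter.tendsto_atBot_add_const_left _ _ Filter.tendsto_neg_atTop_atBot)
  have hint := (integrableOn_cubicMoment 2 z).sub ((integrableOn_cubicMoment 0 z).const_mul z)
  have key := MeasureTheory.integral_Ioi_of_hasDerivAt_of_tendsto (a := 0)
    (hderiv 0).continuousAt.continuousWithinAt (fun r _ => hderiv r) hint hlim
  rw [MeasureTheory.integral_sub (integrableOn_cubicMoment 2 z)
    ((integrableOn_cubicMoment 0 z).const_mul z), MeasureTheory.integral_const_mul] at key
  have : cubicMoment 2 z - z * cubicMoment 0 z = 1 := by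
    rw [cubicMoment, cubicMoment, key]; simp
  linear_combination this

theorem norm_cubicMoment_le (n : ℕ) {z : ℂ} (hz : z.re ≤ 0) :
    ‖cubicMoment n z‖ ≤ ∫ r in Ioi (0:ℝ), r ^ n * exp (-r ^ 3 / 3) := by
  have h0 : MeasureTheory.IntegrableOn (fun r : ℝ => r ^ n * exp (-r ^ 3 / 3)) (Ioi 0) := by
    refine MeasureTheory.IntegrableOn.congr_fun (integrableOn_cubicMoment n 0).norm
      (fun r hr => ?_) measurableSet_Ioi
    simp only [norm_cubicMoment_integrand n 0 (le_of_lt hr)]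
    simp
  refine MeasureTheory.norm_integral_le_of_norm_le h0 ?_
  refine (MeasureTheory.ae_restrict_iff' measurableSet_Ioi).2 (.of_forall fun r hr => ?_)
  rw [norm_cubicMoment_integrand n z (le_of_lt hr)]
  have hr' : 0 < r := hr
  gcongr
  nlinarith

theorem cubicMoment_ofReal (n : ℕ) (x : ℝ) :
    cubicMoment n x = ((∫ r in Ioi (0:ℝ), r ^ n * exp (-r ^ 3 / 3 + x * r) : ℝ) : ℂ) := by
  rw [cubicMoment, ← integral_complex_ofReal]
  push_cast
  rfl

theorem integral_pow_mul_exp_neg_cube (n : ℕ) :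
    ∫ r in Ioi (0:ℝ), r ^ n * exp (-r ^ 3 / 3)
      = (3:ℝ) ^ (((n:ℝ) + 1) / 3 - 1) * Gamma ((n + 1) / 3) := by
  have h := integral_rpow_mul_exp_neg_mul_rpow (p := 3) (q := n) (b := 1 / 3)
    (by norm_num) (by linarith [n.cast_nonneg (α := ℝ)]) (by norm_num)
  have : ∫ r in Ioi (0:ℝ), r ^ n * exp (-r ^ 3 / 3)
      = ∫ x in Ioi (0:ℝ), x ^ (n:ℝ) * exp (-(1 / 3) * x ^ (3:ℝ)) := by
    refine MeasureTheory.setIntegral_congr_fun measurableSet_Ioi fun r hr => ?_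
    simp only [rpow_natCast]
    rw [show (3:ℝ) = (3:ℕ) by norm_num, rpow_natCast]
    congr 2
    push_cast
    ring
  rw [this, h, rpow_sub (by norm_num), rpow_one, one_div, inv_rpow (by norm_num), neg_div,
    rpow_neg (by norm_num), inv_inv]
  ring

theorem integral_abs_pow_mul_exp_neg_mul_sq (k : ℕ) {b : ℝ} (hb : 0 < b) :
    ∫ x : ℝ, |x| ^ k * exp (-b * x ^ 2) = b ^ (-((k:ℝ) + 1) / 2) * Gamma ((k + 1) / 2) := by
  have h := integral_comp_abs (f := fun x => x ^ k * exp (-b * x ^ 2))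
  simp only [sq_abs] at h
  have h2 := integral_rpow_mul_exp_neg_mul_rpow (p := 2) (q := k) (b := b)
    (by norm_num) (by linarith [k.cast_nonneg (α := ℝ)]) hb
  simp only [rpow_natCast, rpow_two] at h2
  rw [h, h2]
  ring

theorem integrable_abs_pow_mul_exp_neg_mul_sq (k : ℕ) {b : ℝ} (hb : 0 < b) :
    MeasureTheory.Integrable fun x : ℝ => |x| ^ k * exp (-b * x ^ 2) := by
  have h := (integrable_rpow_mul_exp_neg_mul_sq hb (s := k)
    (by linarith [k.cast_nonneg (α := ℝ)])).norm
  refine h.congr (.of_forall fun x => ?_)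
  simp only [rpow_natCast, norm_mul, norm_pow, norm_eq_abs, abs_exp]

theorem abs_exp_sub_exp_le {x y z : ℝ} (hx : x ≤ z) (hy : y ≤ z) :
    |exp x - exp y| ≤ |x - y| * exp z := by
  wlog h : y ≤ x generalizing x y
  · rw [abs_sub_comm, abs_sub_comm x]
    exact this hy hx (le_of_not_ge h)
  have h1 : 1 + (y - x) ≤ exp (y - x) := by linarith [add_one_le_exp (y - x)]
  have h2 : exp y = exp x * exp (y - x) := by rw [← exp_add]; ring_nf
  have h3 : exp x ≤ exp z := exp_le_exp.2 hx
  rw [abs_of_nonneg (sub_nonneg.2 (exp_le_exp.2 h)), abs_of_nonneg (sub_nonneg.2 h), h2]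
  nlinarith [exp_pos x, exp_pos z]

theorem laplace_exponent (m r : ℝ) :
    -r ^ 3 / 3 + m ^ 2 * r + -(2 / 3 * m ^ 3) = -((r - m) ^ 2 * (r + 2 * m)) / 3 := by ring

theorem exp_laplace_exponent_le {m r : ℝ} (hr : 0 ≤ r) :
    -((r - m) ^ 2 * (r + 2 * m)) / 3 ≤ -(2 / 3 * m) * (r - m) ^ 2 := by
  nlinarith [mul_nonneg hr (sq_nonneg (r - m))]

theorem abs_indicator_sub_gaussian_le {m : ℝ} (hm : 1 ≤ m) (r : ℝ) :
    |(Ioi (0:ℝ)).indicator (fun r => exp (-((r - m) ^ 2 * (r + 2 * m)) / 3)) r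
        - exp (-m * (r - m) ^ 2)| ≤ |r - m| ^ 3 * exp (-(2 / 3 * m) * (r - m) ^ 2) := by
  have hB : -m * (r - m) ^ 2 ≤ -(2 / 3 * m) * (r - m) ^ 2 := by nlinarith [sq_nonneg (r - m)]
  by_cases hr : r ∈ Ioi (0:ℝ)
  · rw [indicator_of_mem hr]
    refine (abs_exp_sub_exp_le (exp_laplace_exponent_le (le_of_lt hr)) hB).trans ?_
    refine mul_le_mul_of_nonneg_right ?_ (exp_pos _).le
    have : -((r - m) ^ 2 * (r + 2 * m)) / 3 - -m * (r - m) ^ 2 = -((r - m) ^ 3 / 3) := by ring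
    rw [this, abs_neg, abs_div, abs_pow, abs_of_pos (by norm_num : (0:ℝ) < 3)]
    linarith [pow_nonneg (abs_nonneg (r - m)) 3]
  · rw [indicator_of_notMem hr, zero_sub, abs_neg, abs_exp]
    have hr' : r ≤ 0 := not_lt.1 hr
    have h1 : 1 ≤ |r - m| := by rw [abs_of_nonpos (by linarith)]; linarith
    calc exp (-m * (r - m) ^ 2) ≤ 1 * exp (-(2 / 3 * m) * (r - m) ^ 2) := by
          rw [one_mul]; exact exp_le_exp.2 hB
      _ ≤ _ := mul_le_mul_of_nonneg_right (one_le_pow₀ h1) (exp_pos _).le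

theorem integrableOn_laplace {m : ℝ} (hm : 0 < m) (k : ℕ) : MeasureTheory.IntegrableOn
    (fun r : ℝ => (r - m) ^ k * exp (-((r - m) ^ 2 * (r + 2 * m)) / 3)) (Ioi 0) := by
  have h := ((integrable_abs_pow_mul_exp_neg_mul_sq k
    (by positivity : 0 < 2 / 3 * m)).comp_sub_right m).integrableOn (s := Ioi 0)
  refine MeasureTheory.Integrable.mono' h (by fun_prop) ?_
  refine (MeasureTheory.ae_restrict_iff' measurableSet_Ioi).2 (.of_forall fun r hr => ?_)
  rw [norm_mul, norm_pow, norm_eq_abs, norm_eq_abs, abs_exp]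
  exact mul_le_mul_of_nonneg_left (exp_le_exp.2 (exp_laplace_exponent_le (le_of_lt hr)))
    (by positivity)

theorem integral_pow_mul_exp_cubic (m : ℝ) (n : ℕ) :
    (∫ r in Ioi (0:ℝ), r ^ n * exp (-r ^ 3 / 3 + m ^ 2 * r)) * exp (-(2 / 3 * m ^ 3))
      = ∫ r in Ioi (0:ℝ), r ^ n * exp (-((r - m) ^ 2 * (r + 2 * m)) / 3) := by
  rw [← MeasureTheory.integral_mul_const]
  congr 1 with r
  rw [mul_assoc, ← exp_add, laplace_exponent]

theorem abs_laplace_zero_sub_le {m : ℝ} (hm : 1 ≤ m) :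
    |(∫ r in Ioi (0:ℝ), r ^ 0 * exp (-r ^ 3 / 3 + m ^ 2 * r)) * exp (-(2 / 3 * m ^ 3))
      - √(π / m)| ≤ 9 / 4 / m ^ 2 := by
  have hm0 : 0 < m := by linarith
  rw [integral_pow_mul_exp_cubic]
  have h1 : √(π / m) = ∫ r : ℝ, exp (-m * (r - m) ^ 2) := by
    rw [← integral_gaussian, MeasureTheory.integral_sub_right_eq_self (fun r => exp (-m * r ^ 2))]
  have hint := integrableOn_laplace hm0 0
  simp only [pow_zero, one_mul] at hint ⊢
  rw [h1, ← MeasureTheory.integral_indicator measurableSet_Ioi,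
    ← MeasureTheory.integral_sub (hint.integrable_indicator measurableSet_Ioi)
      ((integrable_exp_neg_mul_sq hm0).comp_sub_right m)]
  have hb : 0 < 2 / 3 * m := by positivity
  have h2 := MeasureTheory.norm_integral_le_of_norm_le
    ((integrable_abs_pow_mul_exp_neg_mul_sq 3 hb).comp_sub_right m)
    (.of_forall fun r => (norm_eq_abs _).trans_le (abs_indicator_sub_gaussian_le hm r))
  rw [MeasureTheory.integral_sub_right_eq_self (fun r => |r| ^ 3 * exp (-(2 / 3 * m) * r ^ 2)),
    integral_abs_pow_mul_exp_neg_mul_sq 3 hb] at h2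
  refine h2.trans (le_of_eq ?_)
  have e1 : -(((3:ℕ):ℝ) + 1) / 2 = -((2:ℕ):ℝ) := by norm_num
  have e2 : (((3:ℕ):ℝ) + 1) / 2 = ((1:ℕ):ℝ) + 1 := by norm_num
  rw [e1, e2, Gamma_nat_eq_factorial, rpow_neg hb.le, rpow_natCast]
  simp only [Nat.factorial]
  field_simp
  norm_num

theorem abs_laplace_one_sub_le {m : ℝ} (hm : 1 ≤ m) :
    |(∫ r in Ioi (0:ℝ), r ^ 1 * exp (-r ^ 3 / 3 + m ^ 2 * r)) * exp (-(2 / 3 * m ^ 3))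
      - m * √(π / m)| ≤ 15 / 4 / m := by
  have hm0 : 0 < m := by linarith
  have h0 := abs_laplace_zero_sub_le hm
  rw [integral_pow_mul_exp_cubic] at h0 ⊢
  have hb : 0 < 2 / 3 * m := by positivity
  have hG := (integrable_abs_pow_mul_exp_neg_mul_sq 1 hb).comp_sub_right m
  have hdiff : (∫ r in Ioi (0:ℝ), r ^ 1 * exp (-((r - m) ^ 2 * (r + 2 * m)) / 3))
      - m * ∫ r in Ioi (0:ℝ), r ^ 0 * exp (-((r - m) ^ 2 * (r + 2 * m)) / 3)
      = ∫ r in Ioi (0:ℝ), (r - m) ^ 1 * exp (-((r - m) ^ 2 * (r + 2 * m)) / 3) := by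
    have i0 := (integrableOn_laplace hm0 0).const_mul m
    have i1 := integrableOn_laplace hm0 1
    rw [sub_eq_iff_eq_add, ← MeasureTheory.integral_const_mul,
      ← MeasureTheory.integral_add i1 (by simpa using! i0)]
    congr 1 with r
    ring
  have hle : |∫ r in Ioi (0:ℝ), (r - m) ^ 1 * exp (-((r - m) ^ 2 * (r + 2 * m)) / 3)|
      ≤ 3 / 2 / m := by
    have h2 := MeasureTheory.norm_integral_le_of_norm_le
      (f := fun r => (r - m) ^ 1 * exp (-((r - m) ^ 2 * (r + 2 * m)) / 3))
      (hG.integrableOn (s := Ioi 0)) (by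
        refine (MeasureTheory.ae_restrict_iff' measurableSet_Ioi).2 (.of_forall fun r hr => ?_)
        rw [norm_mul, norm_pow, norm_eq_abs, norm_eq_abs, abs_exp]
        exact mul_le_mul_of_nonneg_left (exp_le_exp.2 (exp_laplace_exponent_le (le_of_lt hr)))
          (by positivity))
    refine h2.trans ((MeasureTheory.setIntegral_le_integral hG
      (.of_forall fun r => by positivity)).trans (le_of_eq ?_))
    rw [MeasureTheory.integral_sub_right_eq_self (fun r => |r| ^ 1 * exp (-(2 / 3 * m) * r ^ 2)),
      integral_abs_pow_mul_exp_neg_mul_sq 1 hb]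
    have e1 : -(((1:ℕ):ℝ) + 1) / 2 = -1 := by norm_num
    have e2 : (((1:ℕ):ℝ) + 1) / 2 = 1 := by norm_num
    rw [e1, e2, Gamma_one, rpow_neg_one]
    field_simp
  rw [← hdiff] at hle
  set A := ∫ r in Ioi (0:ℝ), r ^ 1 * exp (-((r - m) ^ 2 * (r + 2 * m)) / 3)
  set B := ∫ r in Ioi (0:ℝ), r ^ 0 * exp (-((r - m) ^ 2 * (r + 2 * m)) / 3)
  have h3 : |m * (B - √(π / m))| ≤ 9 / 4 / m := by
    rw [abs_mul, abs_of_pos hm0]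
    calc m * |B - √(π / m)| ≤ m * (9 / 4 / m ^ 2) := by gcongr
      _ = 9 / 4 / m := by field_simp
  have h4 : A - m * √(π / m) = (A - m * B) + m * (B - √(π / m)) := by ring
  have h5 : (15 / 4 / m : ℝ) = 3 / 2 / m + 9 / 4 / m := by ring
  rw [h4, h5]
  exact (abs_add_le _ _).trans (add_le_add hle h3)

/-- `f` solves the Airy equation `f'' = x f` and has derivative `f'`. -/
structure IsAirySolution (f f' : ℝ → ℝ) : Prop where
  deriv : ∀ x, HasDerivAt f (f' x) x
  deriv' : ∀ x, HasDerivAt f' (x * f x) x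

namespace IsAirySolution

variable {f f' g g' u u' v v' : ℝ → ℝ}

theorem wronskian_eq (hf : IsAirySolution f f') (hg : IsAirySolution g g') (x y : ℝ) :
    f x * g' x - f' x * g x = f y * g' y - f' y * g y := by
  have h : ∀ x, HasDerivAt (fun x => f x * g' x - f' x * g x) 0 x := fun x =>
    (((hf.deriv x).mul (hg.deriv' x)).sub ((hf.deriv' x).mul (hg.deriv x))).congr_deriv (by ring)
  exact is_const_of_deriv_eq_zero (fun x => (h x).differentiableAt) (fun x => (h x).deriv) x y

theorem sub_div_const (hf : IsAirySolution f f') (hg : IsAirySolution g g') (c : ℝ) :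
    IsAirySolution (fun x => f x - g x / c) (fun x => f' x - g' x / c) :=
  ⟨fun x => (hf.deriv x).sub ((hg.deriv x).div_const c),
    fun x => ((hf.deriv' x).sub ((hg.deriv' x).div_const c)).congr_deriv (by ring)⟩

theorem eq_of_initial (hf : IsAirySolution f f') (hg : IsAirySolution g g')
    (h0 : f 0 = g 0) (h0' : f' 0 = g' 0) {u u' v v' : ℝ → ℝ} (hu : IsAirySolution u u')
    (hv : IsAirySolution v v') (huv : u 0 * v' 0 - u' 0 * v 0 = 1) (x : ℝ) :
    f x = g x ∧ f' x = g' x := by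
  have e1 := hu.wronskian_eq hv x 0
  have e2 := hf.wronskian_eq hv x 0
  have e3 := hf.wronskian_eq hu x 0
  have e4 := hg.wronskian_eq hv x 0
  have e5 := hg.wronskian_eq hu x 0
  rw [huv] at e1
  rw [h0, h0', ← e4] at e2
  rw [h0, h0', ← e5] at e3
  constructor
  · linear_combination (g x - f x) * e1 + u x * e2 - v x * e3
  · linear_combination (g' x - f' x) * e1 + u' x * e2 - v' x * e3

end IsAirySolution

theorem hasDerivAt_rotated {ω : ℂ} (x : ℂ) :
    HasDerivAt (fun x => ω * cubicMoment 0 (ω * x)) (ω ^ 2 * cubicMoment 1 (ω * x)) x :=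
  (((hasDerivAt_cubicMoment 0 (ω * x)).comp x ((hasDerivAt_id x).const_mul ω)).const_mul
    ω).congr_deriv (by simp only [zero_add]; ring)

theorem hasDerivAt_rotated' {ω : ℂ} (hω : ω ^ 3 = 1) (x : ℂ) :
    HasDerivAt (fun x => ω ^ 2 * cubicMoment 1 (ω * x))
      (1 + x * (ω * cubicMoment 0 (ω * x))) x :=
  (((hasDerivAt_cubicMoment 1 (ω * x)).comp x ((hasDerivAt_id x).const_mul ω)).const_mul
    (ω ^ 2)).congr_deriv (by
      rw [one_add_one_eq_two, cubicMoment_two]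
      linear_combination (1 + ω * x * cubicMoment 0 (ω * x)) * hω)

theorem isAirySolution_rotated {ω : ℂ} (hω : ω ^ 3 = 1) (k : ℂ) :
    IsAirySolution (fun x => (k * (cubicMoment 0 x - ω * cubicMoment 0 (ω * x))).re)
      (fun x => (k * (cubicMoment 1 x - ω ^ 2 * cubicMoment 1 (ω * x))).re) := by
  constructor
  · intro x
    have := (((hasDerivAt_cubicMoment 0 x).sub (hasDerivAt_rotated (ω := ω) x)).const_mul
      k).real_of_complex
    simpa using! this
  · intro x
    have := (((hasDerivAt_cubicMoment 1 x).sub (hasDerivAt_rotated' hω x)).const_mul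
      k).real_of_complex
    refine this.congr_deriv ?_
    rw [one_add_one_eq_two, cubicMoment_two, ← Complex.re_ofReal_mul]
    congr 1
    ring

theorem cubicMoment_zero_pos (n : ℕ) : 0 < ∫ r in Ioi (0:ℝ), r ^ n * exp (-r ^ 3 / 3) := by
  rw [integral_pow_mul_exp_neg_cube]
  have := Gamma_pos_of_pos (s := ((n:ℝ) + 1) / 3) (by positivity)
  positivity

theorem airyAlpha_pos : 0 < airyAlpha := by
  have h1 := Gamma_pos_of_pos (s := 1 / 3) (by norm_num)
  have h2 := Gamma_pos_of_pos (s := 2 / 3) (by norm_num)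
  unfold airyAlpha
  positivity

theorem moment_zero_eq_airyAlpha_mul :
    ∫ r in Ioi (0:ℝ), r ^ 0 * exp (-r ^ 3 / 3)
      = airyAlpha * ∫ r in Ioi (0:ℝ), r ^ 1 * exp (-r ^ 3 / 3) := by
  rw [integral_pow_mul_exp_neg_cube, integral_pow_mul_exp_neg_cube, airyAlpha]
  have h2 := Gamma_pos_of_pos (s := 2 / 3) (by norm_num)
  have e1 : ((0:ℕ):ℝ) + 1 = 1 := by norm_num
  have e2 : ((1:ℕ):ℝ) + 1 = 2 := by norm_num
  rw [e1, e2, show ((1:ℝ) / 3 - 1) = (2 / 3 - 1) - 1 / 3 by norm_num, rpow_sub (by norm_num)]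
  field_simp

theorem sq_moment_one_div_two_pi :
    (3 * ∫ r in Ioi (0:ℝ), r ^ 1 * exp (-r ^ 3 / 3)) ^ 2 / (2 * π) = √3 / airyAlpha := by
  have h1 := Gamma_pos_of_pos (s := 1 / 3) (by norm_num)
  have h2 := Gamma_pos_of_pos (s := 2 / 3) (by norm_num)
  have h3 := Gamma_mul_Gamma_one_sub (1 / 3)
  rw [show (1:ℝ) - 1 / 3 = 2 / 3 by norm_num, show π * (1 / 3) = π / 3 by ring, sin_pi_div_three]
    at h3
  have h4 : Gamma (1 / 3) * Gamma (2 / 3) * √3 = 2 * π := by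
    rw [h3]; field_simp
  rw [integral_pow_mul_exp_neg_cube, airyAlpha, ← h4]
  have e2 : ((1:ℕ):ℝ) + 1 = 2 := by norm_num
  have e3 : (3:ℝ) ^ ((2:ℝ) / 3 - 1) = ((3:ℝ) ^ ((1:ℝ) / 3))⁻¹ := by
    rw [← rpow_neg (by norm_num)]; norm_num
  have e4 : ((3:ℝ) ^ ((1:ℝ) / 3)) ^ 3 = 3 := by
    rw [← rpow_natCast, ← rpow_mul (by norm_num)]; norm_num
  have e5 : √3 ^ 2 = 3 := sq_sqrt (by norm_num)
  rw [e2, e3]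
  have e6 : 0 < (3:ℝ) ^ ((1:ℝ) / 3) := by positivity
  set t := (3:ℝ) ^ ((1:ℝ) / 3)
  field_simp
  rw [e5, e4]
  norm_num

/-- The primitive cube root of unity in the upper half plane. -/
noncomputable def cubeRootOfUnity : ℂ := ⟨-(1 / 2), √3 / 2⟩

theorem cubeRootOfUnity_sq : cubeRootOfUnity ^ 2 = ⟨-(1 / 2), -(√3 / 2)⟩ := by
  have e5 : √3 ^ 2 = 3 := sq_sqrt (by norm_num)
  rw [sq]
  apply Complex.ext <;> simp only [cubeRootOfUnity, Complex.mul_re, Complex.mul_im] <;> nlinarith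

theorem cubeRootOfUnity_cube : cubeRootOfUnity ^ 3 = 1 := by
  have e5 : √3 ^ 2 = 3 := sq_sqrt (by norm_num)
  rw [pow_succ, cubeRootOfUnity_sq]
  apply Complex.ext <;> simp [cubeRootOfUnity, Complex.mul_re, Complex.mul_im] <;> nlinarith

theorem norm_cubeRootOfUnity : ‖cubeRootOfUnity‖ = 1 :=
  Complex.norm_eq_one_of_pow_eq_one cubeRootOfUnity_cube (by norm_num)

theorem norm_rotated_le (n k : ℕ) {x : ℝ} (hx : 0 ≤ x) :
    ‖cubeRootOfUnity ^ k * cubicMoment n (cubeRootOfUnity * x)‖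
      ≤ ∫ r in Ioi (0:ℝ), r ^ n * exp (-r ^ 3 / 3) := by
  rw [norm_mul, norm_pow, norm_cubeRootOfUnity, one_pow, one_mul]
  refine norm_cubicMoment_le n ?_
  rw [Complex.re_mul_ofReal, cubeRootOfUnity]
  simp only
  linarith

theorem cubicMoment_apply_zero (n : ℕ) :
    cubicMoment n 0 = ((∫ r in Ioi (0:ℝ), r ^ n * exp (-r ^ 3 / 3) : ℝ) : ℂ) := by
  simpa using cubicMoment_ofReal n 0

theorem re_mul_initial (k : ℂ) :
    (k * (cubicMoment 0 (0:ℝ) - cubeRootOfUnity * cubicMoment 0 (cubeRootOfUnity * (0:ℝ)))).re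
      = (k.re * (3 / 2) + k.im * (√3 / 2)) * ∫ r in Ioi (0:ℝ), r ^ 0 * exp (-r ^ 3 / 3) := by
  rw [Complex.ofReal_zero, mul_zero, cubicMoment_apply_zero]
  simp only [Complex.mul_re, Complex.sub_re, Complex.sub_im, Complex.mul_im, Complex.ofReal_re,
    Complex.ofReal_im, cubeRootOfUnity]
  ring

theorem re_mul_initial' (k : ℂ) :
    (k * (cubicMoment 1 (0:ℝ)
        - cubeRootOfUnity ^ 2 * cubicMoment 1 (cubeRootOfUnity * (0:ℝ)))).re
      = (k.re * (3 / 2) - k.im * (√3 / 2)) * ∫ r in Ioi (0:ℝ), r ^ 1 * exp (-r ^ 3 / 3) := by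
  rw [Complex.ofReal_zero, mul_zero, cubicMoment_apply_zero, cubeRootOfUnity_sq]
  simp only [Complex.mul_re, Complex.sub_re, Complex.sub_im, Complex.mul_im, Complex.ofReal_re,
    Complex.ofReal_im]
  ring

theorem abs_re_mul_sub_le (n k : ℕ) (z : ℂ) {x : ℝ} (hx : 0 ≤ x) :
    |(z * (cubicMoment n x - cubeRootOfUnity ^ k * cubicMoment n (cubeRootOfUnity * x))).re
        - z.re * ∫ r in Ioi (0:ℝ), r ^ n * exp (-r ^ 3 / 3 + x * r)|
      ≤ ‖z‖ * ∫ r in Ioi (0:ℝ), r ^ n * exp (-r ^ 3 / 3) := by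
  rw [cubicMoment_ofReal, mul_sub, Complex.sub_re, Complex.re_mul_ofReal, sub_sub_cancel_left,
    abs_neg]
  refine (Complex.abs_re_le_norm _).trans ?_
  rw [norm_mul]
  exact mul_le_mul_of_nonneg_left (norm_rotated_le n k hx) (norm_nonneg z)

/-- `u - v / α` is bounded on the positive half line, while `v` agrees with a multiple of
`∫₀^∞ exp(-r³/3 + x r) dr` up to a bounded error; the same holds for the derivatives. -/
theorem canonical_solutions_bound {u u' v v' : ℝ → ℝ} (hu : IsAirySolution u u')
    (hv : IsAirySolution v v') (hu0 : u 0 = 1) (hu'0 : u' 0 = 0) (hv0 : v 0 = 0) (hv'0 : v' 0 = 1) :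
    ∃ B, ∀ x, 0 ≤ x → |u x - v x / airyAlpha| ≤ B ∧ |u' x - v' x / airyAlpha| ≤ B ∧
      |v x - (3 * ∫ r in Ioi (0:ℝ), r ^ 1 * exp (-r ^ 3 / 3))⁻¹ *
        ∫ r in Ioi (0:ℝ), r ^ 0 * exp (-r ^ 3 / 3 + x * r)| ≤ B ∧
      |v' x - (3 * ∫ r in Ioi (0:ℝ), r ^ 1 * exp (-r ^ 3 / 3))⁻¹ *
        ∫ r in Ioi (0:ℝ), r ^ 1 * exp (-r ^ 3 / 3 + x * r)| ≤ B := by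
  have huv : u 0 * v' 0 - u' 0 * v 0 = 1 := by rw [hu0, hu'0, hv0, hv'0]; norm_num
  have hp0 := moment_zero_eq_airyAlpha_mul
  have hp1 := cubicMoment_zero_pos 1
  have hα := airyAlpha_pos
  have h3 : 0 < √3 := by positivity
  have e5 : √3 ^ 2 = 3 := sq_sqrt (by norm_num)
  have b0 := fun z x => abs_re_mul_sub_le 0 1 z (x := x)
  have b1 := fun z x => abs_re_mul_sub_le 1 2 z (x := x)
  simp only [pow_one cubeRootOfUnity] at b0
  set p0 := ∫ r in Ioi (0:ℝ), r ^ 0 * exp (-r ^ 3 / 3) with hp0d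
  set p1 := ∫ r in Ioi (0:ℝ), r ^ 1 * exp (-r ^ 3 / 3) with hp1d
  have hp0' : 0 < p0 := by rw [hp0]; positivity
  have key : ∀ (k : ℂ) (f f' : ℝ → ℝ), IsAirySolution f f' →
      f 0 = (k.re * (3 / 2) + k.im * (√3 / 2)) * p0 →
      f' 0 = (k.re * (3 / 2) - k.im * (√3 / 2)) * p1 → ∀ x, 0 ≤ x →
      |f x - k.re * ∫ r in Ioi (0:ℝ), r ^ 0 * exp (-r ^ 3 / 3 + x * r)| ≤ ‖k‖ * (p0 + p1) ∧
      |f' x - k.re * ∫ r in Ioi (0:ℝ), r ^ 1 * exp (-r ^ 3 / 3 + x * r)| ≤ ‖k‖ * (p0 + p1) := by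
    intro k f f' hf h0 h0' x hx
    obtain ⟨ef, ef'⟩ := hf.eq_of_initial (isAirySolution_rotated cubeRootOfUnity_cube k)
      (h0.trans (re_mul_initial k).symm) (h0'.trans (re_mul_initial' k).symm) hu hv huv x
    rw [ef, ef']
    exact ⟨(b0 k x hx).trans (mul_le_mul_of_nonneg_left (by linarith) (norm_nonneg k)),
      (b1 k x hx).trans (mul_le_mul_of_nonneg_left (by linarith) (norm_nonneg k))⟩
  have kw := key ⟨0, 2 / (√3 * p0)⟩ _ _ (hu.sub_div_const hv airyAlpha)
    (by simp only [hu0, hv0]; field_simp; norm_num)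
    (by simp only [hu'0, hv'0, hp0]; field_simp; norm_num)
  have kv := key ⟨(3 * p1)⁻¹, -(1 / (√3 * p1))⟩ _ _ hv
    (by simp only [hv0]; field_simp; norm_num)
    (by simp only [hv'0]; field_simp; norm_num)
  simp only [zero_mul, sub_zero] at kw
  refine ⟨max _ _, fun x hx => ⟨(kw x hx).1.trans (le_max_left _ _),
    (kw x hx).2.trans (le_max_left _ _), (kv x hx).1.trans (le_max_right _ _),
    (kv x hx).2.trans (le_max_right _ _)⟩⟩

theorem sq_le_exp_two_thirds_cube {m : ℝ} (hm : 1 ≤ m) : m ^ 2 ≤ exp (2 / 3 * m ^ 3) := by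
  have h1 := add_one_le_exp (2 / 3 * m ^ 3)
  nlinarith [mul_nonneg (by linarith : (0:ℝ) ≤ m - 1) (sq_nonneg m), sq_nonneg (m - 1)]

theorem inv_sq_wkb_estimate {κ C m z : ℝ} (hκ : 0 < κ) (hm : 1 ≤ m) (hmC : 2 * C ≤ m)
    (hz : |κ * z * exp (-(2 / 3 * m ^ 3)) - √(π / m)| ≤ C / m ^ 2) :
    m / (2 * κ) ≤ z ∧
      |(z ^ 2)⁻¹ - κ ^ 2 / π * m * exp (-(4 / 3) * m ^ 3)|
        ≤ 10 * κ ^ 2 * C * exp (-(4 / 3) * m ^ 3) := by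
  have hm0 : 0 < m := by linarith
  have hC : 0 ≤ C := by
    have := (abs_nonneg _).trans hz
    by_contra h
    have : C / m ^ 2 < 0 := div_neg_of_neg_of_pos (not_le.1 h) (by positivity)
    linarith
  have hS2 : √(π / m) ^ 2 = π / m := sq_sqrt (by positivity)
  have hS1 : 1 / m ≤ √(π / m) := by
    apply le_sqrt_of_sq_le
    rw [div_pow, one_pow, div_le_div_iff₀ (by positivity) hm0]
    nlinarith [pi_gt_three, mul_pos hm0 hm0]
  have hE : exp (-(4 / 3) * m ^ 3) = exp (-(2 / 3 * m ^ 3)) ^ 2 := by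
    rw [← exp_nat_mul]; congr 1; push_cast; ring
  have hzT : z = κ * z * exp (-(2 / 3 * m ^ 3)) * exp (2 / 3 * m ^ 3) / κ := by
    rw [mul_assoc, ← exp_add, neg_add_cancel, exp_zero]; field_simp
  set S := √(π / m)
  set T := κ * z * exp (-(2 / 3 * m ^ 3)) with hT
  have hCm : C / m ^ 2 ≤ 1 / m / 2 := by
    rw [div_div, div_le_div_iff₀ (by positivity) (by positivity)]
    nlinarith
  have h1m : 0 < 1 / m := by positivity
  have hS0 : 0 < S := by linarith
  obtain ⟨hl, hr⟩ := abs_le.1 (hz.trans hCm)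
  have hTS : S / 2 ≤ T := by linarith
  have hTS' : T ≤ 3 / 2 * S := by linarith
  have hT0 : 0 < T := by linarith
  constructor
  · rw [hzT]
    have h2 := sq_le_exp_two_thirds_cube hm
    have h3 : 1 / m / 2 * m ^ 2 ≤ T * exp (2 / 3 * m ^ 3) :=
      mul_le_mul (by linarith) h2 (by positivity) hT0.le
    calc m / (2 * κ) = 1 / m / 2 * m ^ 2 / κ := by field_simp
      _ ≤ _ := by gcongr
  · have hzinv : (z ^ 2)⁻¹ = κ ^ 2 * (T ^ 2)⁻¹ * exp (-(4 / 3) * m ^ 3) := by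
      have hE0 := exp_pos (-(2 / 3 * m ^ 3))
      have hz0 : z ≠ 0 := by
        rintro rfl
        simp [hT] at hT0
      rw [hE, hT]
      field_simp
    have hmS : κ ^ 2 / π * m = κ ^ 2 * (S ^ 2)⁻¹ := by rw [hS2]; field_simp
    rw [hzinv, hmS, ← sub_mul, abs_mul, abs_of_pos (exp_pos _)]
    refine mul_le_mul_of_nonneg_right ?_ (exp_pos _).le
    have h4 : κ ^ 2 * (T ^ 2)⁻¹ - κ ^ 2 * (S ^ 2)⁻¹
        = κ ^ 2 * ((S - T) * (S + T)) / (T ^ 2 * S ^ 2) := by field_simp; ring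
    rw [h4, abs_div, abs_mul, abs_mul, abs_of_pos (by positivity : 0 < κ ^ 2),
      abs_of_pos (by positivity : 0 < S + T), abs_of_pos (by positivity : 0 < T ^ 2 * S ^ 2),
      div_le_iff₀ (by positivity), abs_sub_comm]
    suffices h : |T - S| * (S + T) ≤ 10 * (C * (T ^ 2 * S ^ 2)) from
      (mul_le_mul_of_nonneg_left h (by positivity : 0 ≤ κ ^ 2)).trans_eq (by ring)
    have hb : 1 ≤ m ^ 2 * S ^ 3 := by
      have : m ^ 2 * S ^ 3 = π * (m * S) := by
        rw [pow_succ S 2, hS2]; field_simp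
      rw [this]
      have : 1 ≤ m * S := by
        calc 1 = m * (1 / m) := by field_simp
          _ ≤ m * S := by gcongr
      nlinarith [pi_gt_three]
    calc |T - S| * (S + T) ≤ C / m ^ 2 * (5 / 2 * S) :=
          mul_le_mul hz (by linarith) (by positivity) (by positivity)
      _ ≤ C / m ^ 2 * (5 / 2 * S) * (m ^ 2 * S ^ 3) := le_mul_of_one_le_right (by positivity) hb
      _ = 10 * (C * ((S / 2) ^ 2 * S ^ 2)) := by field_simp; ring
      _ ≤ 10 * (C * (T ^ 2 * S ^ 2)) := by gcongr

theorem hasDerivAt_exp_sqrt_cube {y : ℝ} (hy : 0 < y) :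
    HasDerivAt (fun y => exp (-(4 / 3) * √y ^ 3)) (-(2 * √y * exp (-(4 / 3) * √y ^ 3))) y := by
  have h := ((((hasDerivAt_id y).sqrt hy.ne').pow 3).const_mul (-(4 / 3))).exp
  have hs : 0 < √y := sqrt_pos.2 hy
  refine h.congr_deriv ?_
  simp only [id, Pi.pow_apply]
  field_simp
  push_cast
  ring

theorem hasDerivAt_exp_sqrt_cube_div_sqrt {y : ℝ} (hy : 0 < y) :
    HasDerivAt (fun y => exp (-(4 / 3) * √y ^ 3) / √y)
      (-((2 + 1 / (2 * √y ^ 3)) * exp (-(4 / 3) * √y ^ 3))) y := by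
  have hs : 0 < √y := sqrt_pos.2 hy
  refine ((hasDerivAt_exp_sqrt_cube hy).div ((hasDerivAt_id y).sqrt hy.ne') hs.ne').congr_deriv ?_
  simp only [id]
  field_simp
  ring

theorem tendsto_exp_sqrt_cube :
    Filter.Tendsto (fun y => exp (-(4 / 3) * √y ^ 3)) Filter.atTop (nhds 0) :=
  tendsto_exp_atBot.comp (Filter.Tendsto.const_mul_atTop_of_neg (r := (-(4 / 3) : ℝ)) (by norm_num)
    ((Filter.tendsto_pow_atTop (n := 3) (by norm_num)).comp tendsto_sqrt_atTop))

theorem tendsto_exp_sqrt_cube_div_sqrt :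
    Filter.Tendsto (fun y => exp (-(4 / 3) * √y ^ 3) / √y) Filter.atTop (nhds 0) :=
  tendsto_exp_sqrt_cube.div_atTop tendsto_sqrt_atTop

theorem nonpos_of_deriv_nonneg_of_tendsto_zero {g g' : ℝ → ℝ} {Y : ℝ}
    (hg : ∀ y, Y ≤ y → HasDerivAt g (g' y) y) (hg' : ∀ y, Y ≤ y → 0 ≤ g' y)
    (hlim : Filter.Tendsto g Filter.atTop (nhds 0)) {y : ℝ} (hy : Y ≤ y) : g y ≤ 0 := by
  have hmono : MonotoneOn g (Ici Y) := by
    refine monotoneOn_of_hasDerivWithinAt_nonneg (f' := g') (convex_Ici Y)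
      (fun x hx => (hg x hx).continuousAt.continuousWithinAt)
      (fun x hx => (hg x (interior_subset hx)).hasDerivWithinAt)
      (fun x hx => hg' x (interior_subset hx))
  refine ge_of_tendsto hlim ?_
  filter_upwards [Filter.eventually_ge_atTop y] with x hx
  exact hmono hy (hy.trans hx) hx

/-- Integrating `-f' ≈ 2 r √y exp(-4/3 y^(3/2))` from infinity. -/
theorem tail_estimate {f D : ℝ → ℝ} {r M Y : ℝ} (hY : 0 < Y)
    (hf : ∀ y, Y ≤ y → HasDerivAt f (-D y) y)
    (hD : ∀ y, Y ≤ y → |D y - 2 * r * √y * exp (-(4 / 3) * √y ^ 3)|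
      ≤ M * exp (-(4 / 3) * √y ^ 3))
    (hlim : Filter.Tendsto f Filter.atTop (nhds 0)) {y : ℝ} (hy : Y ≤ y) :
    |f y - r * exp (-(4 / 3) * √y ^ 3)| ≤ M / 2 * (exp (-(4 / 3) * √y ^ 3) / √y) := by
  have hM : 0 ≤ M := by
    by_contra h
    have := (abs_nonneg _).trans (hD Y le_rfl)
    nlinarith [exp_pos (-(4 / 3) * √Y ^ 3)]
  have hlim' : ∀ s : ℝ, Filter.Tendsto (fun y => s * (f y - r * exp (-(4 / 3) * √y ^ 3))
      - M / 2 * (exp (-(4 / 3) * √y ^ 3) / √y)) Filter.atTop (nhds 0) := by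
    intro s
    have := ((hlim.sub (tendsto_exp_sqrt_cube.const_mul r)).const_mul s).sub
      (tendsto_exp_sqrt_cube_div_sqrt.const_mul (M / 2))
    simpa using this
  have hder : ∀ s : ℝ, ∀ y, Y ≤ y → HasDerivAt (fun y => s * (f y - r * exp (-(4 / 3) * √y ^ 3))
      - M / 2 * (exp (-(4 / 3) * √y ^ 3) / √y))
      (M / (4 * √y ^ 3) * exp (-(4 / 3) * √y ^ 3) + (M * exp (-(4 / 3) * √y ^ 3)
        - s * (D y - 2 * r * √y * exp (-(4 / 3) * √y ^ 3)))) y := by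
    intro s y hy
    have hy0 : 0 < y := hY.trans_le hy
    have hs : 0 < √y := sqrt_pos.2 hy0
    refine ((((hf y hy).sub ((hasDerivAt_exp_sqrt_cube hy0).const_mul r)).const_mul s).sub
      ((hasDerivAt_exp_sqrt_cube_div_sqrt hy0).const_mul (M / 2))).congr_deriv ?_
    field_simp
    ring
  have hE := fun y => (exp_pos (-(4 / 3) * √y ^ 3)).le
  have h1 := nonpos_of_deriv_nonneg_of_tendsto_zero (hder 1)
    (fun y hy => add_nonneg (mul_nonneg (by positivity) (hE y))
      (by linarith [(abs_le.1 (hD y hy)).2])) (hlim' 1) hy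
  have h2 := nonpos_of_deriv_nonneg_of_tendsto_zero (hder (-1))
    (fun y hy => add_nonneg (mul_nonneg (by positivity) (hE y))
      (by linarith [(abs_le.1 (hD y hy)).1])) (hlim' (-1)) hy
  rw [abs_le]
  constructor <;> linarith

theorem wkb_ratio_estimate {f z : ℝ → ℝ} {κ C B : ℝ} (hκ : 0 < κ)
    (hz : ∀ y, 1 ≤ y → |κ * z y * exp (-(2 / 3 * √y ^ 3)) - √(π / √y)| ≤ C / √y ^ 2)
    (hf : ∀ y, 1 ≤ y → z y ≠ 0 → HasDerivAt f (-(z y ^ 2)⁻¹) y)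
    (hfz : ∀ y, 1 ≤ y → |f y| ≤ B / |z y|) :
    ∃ M Y, 1 ≤ Y ∧ ∀ y, Y ≤ y → z y ≠ 0 ∧
      |f y - κ ^ 2 / (2 * π) * exp (-(4 / 3) * √y ^ 3)| ≤ M * exp (-(4 / 3) * √y ^ 3) / √y := by
  set Y := max 1 ((2 * C) ^ 2) with hYd
  have h1 : ∀ y, Y ≤ y → 1 ≤ y := fun y hy => (le_max_left _ _).trans hy
  have key : ∀ y, Y ≤ y → √y / (2 * κ) ≤ z y ∧
      |(z y ^ 2)⁻¹ - κ ^ 2 / π * √y * exp (-(4 / 3) * √y ^ 3)|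
        ≤ 10 * κ ^ 2 * C * exp (-(4 / 3) * √y ^ 3) := fun y hy =>
    inv_sq_wkb_estimate hκ (by rw [one_le_sqrt]; exact h1 y hy)
      (le_sqrt_of_sq_le ((le_max_right _ _).trans hy)) (hz y (h1 y hy))
  have hzpos : ∀ y, Y ≤ y → 0 < z y := fun y hy => by
    have : 0 < √y := sqrt_pos.2 (by linarith [h1 y hy])
    exact lt_of_lt_of_le (by positivity) (key y hy).1
  have hlim : Filter.Tendsto f Filter.atTop (nhds 0) := by
    refine squeeze_zero_norm' (a := fun y => |B| * (2 * κ) / √y) ?_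
      (tendsto_const_nhds.div_atTop tendsto_sqrt_atTop)
    filter_upwards [Filter.eventually_ge_atTop Y] with y hy
    have hs : 0 < √y := sqrt_pos.2 (by linarith [h1 y hy])
    have hzp := hzpos y hy
    refine (hfz y (h1 y hy)).trans ?_
    rw [abs_of_pos hzp]
    calc B / z y ≤ |B| / z y := by
          gcongr
          exact le_abs_self B
      _ ≤ |B| / (√y / (2 * κ)) := by
          have := (key y hy).1
          gcongr
      _ = |B| * (2 * κ) / √y := by field_simp
  refine ⟨10 * κ ^ 2 * C / 2, Y, le_max_left _ _, fun y hy => ⟨(hzpos y hy).ne', ?_⟩⟩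
  have := tail_estimate (r := κ ^ 2 / (2 * π)) (M := 10 * κ ^ 2 * C)
    (lt_of_lt_of_le one_pos (le_max_left _ _))
    (fun y hy => hf y (h1 y hy) (hzpos y hy).ne') (fun y hy => by
      have e : 2 * (κ ^ 2 / (2 * π)) = κ ^ 2 / π := by field_simp
      rw [e]
      exact (key y hy).2) hlim hy
  rwa [mul_div_assoc]

/-- Asymptotics of the ratios of the recessive and the dominant Airy solution. -/
theorem recessive_ratio_asymptotics {u u' v v' : ℝ → ℝ} (hu : IsAirySolution u u')
    (hv : IsAirySolution v v') (hu0 : u 0 = 1) (hu'0 : u' 0 = 0) (hv0 : v 0 = 0) (hv'0 : v' 0 = 1) :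
    (∃ M Y, 1 ≤ Y ∧ ∀ y, Y ≤ y → v y ≠ 0 ∧
      |(u y - v y / airyAlpha) / v y - √3 / airyAlpha * exp (-(4 / 3) * √y ^ 3)|
        ≤ M * exp (-(4 / 3) * √y ^ 3) / √y) ∧
    (∃ M Y, 1 ≤ Y ∧ ∀ y, Y ≤ y → v' y ≠ 0 ∧
      |(u' y - v' y / airyAlpha) / v' y - -(√3 / airyAlpha) * exp (-(4 / 3) * √y ^ 3)|
        ≤ M * exp (-(4 / 3) * √y ^ 3) / √y) := by
  obtain ⟨B, hB⟩ := canonical_solutions_bound hu hv hu0 hu'0 hv0 hv'0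
  have hr := sq_moment_one_div_two_pi
  have hp1 := cubicMoment_zero_pos 1
  have hα := airyAlpha_pos
  have hw := hu.sub_div_const hv airyAlpha
  have hW : ∀ x, (u x - v x / airyAlpha) * v' x - (u' x - v' x / airyAlpha) * v x = 1 := by
    intro x
    have := hw.wronskian_eq hv x 0
    simpa [hu0, hu'0, hv0, hv'0] using this
  set κ := 3 * ∫ r in Ioi (0:ℝ), r ^ 1 * exp (-r ^ 3 / 3) with hκd
  have hκ : 0 < κ := by positivity
  have hB0 : 0 ≤ B := (abs_nonneg _).trans (hB 0 le_rfl).1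
  have hκB : 0 ≤ κ * B := by positivity
  have hbound : ∀ m V P S A : ℝ, 1 ≤ m → |V - κ⁻¹ * P| ≤ B →
      |P * exp (-(2 / 3 * m ^ 3)) - S| ≤ A →
      |κ * V * exp (-(2 / 3 * m ^ 3)) - S| ≤ κ * B / m ^ 2 + A := by
    intro m V P S A hm hV hP
    have hE : exp (-(2 / 3 * m ^ 3)) ≤ 1 / m ^ 2 := by
      rw [exp_neg, ← one_div]
      exact one_div_le_one_div_of_le (by positivity) (sq_le_exp_two_thirds_cube hm)
    have hsplit : κ * V * exp (-(2 / 3 * m ^ 3)) - S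
        = κ * (V - κ⁻¹ * P) * exp (-(2 / 3 * m ^ 3)) + (P * exp (-(2 / 3 * m ^ 3)) - S) := by
      field_simp; ring
    rw [hsplit]
    refine (abs_add_le _ _).trans (add_le_add ?_ hP)
    rw [abs_mul, abs_mul, abs_of_pos hκ, abs_exp, ← mul_one_div (κ * B)]
    gcongr
  rw [← hr]
  constructor
  · refine wkb_ratio_estimate (z := v) (C := κ * B + 9 / 4) (B := B) hκ ?_ ?_ ?_
    · intro y hy
      have hm : 1 ≤ √y := one_le_sqrt.2 hy
      have h1 := abs_laplace_zero_sub_le hm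
      have h2 := (hB y (by linarith)).2.2.1
      rw [sq_sqrt (by linarith)] at h1
      have h3 := hbound _ _ _ _ _ hm h2 h1
      rw [sq_sqrt (by linarith)] at h3 ⊢
      rwa [← add_div] at h3
    · intro y hy hz
      refine ((hw.deriv y).div (hv.deriv y) hz).congr_deriv ?_
      rw [inv_eq_one_div, ← neg_div]
      congr 1
      linarith [hW y]
    · intro y hy
      rw [abs_div]
      have := (hB y (by linarith)).1
      gcongr
  · have main := wkb_ratio_estimate (z := fun y => v' y / √y) (C := κ * B + 15 / 4) (B := B)
      (f := fun y => -((u' y - v' y / airyAlpha) / v' y)) hκ ?_ ?_ ?_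
    · obtain ⟨M, Y, hY, h⟩ := main
      refine ⟨M, Y, hY, fun y hy => ⟨fun h0 => (h y hy).1 (by simp [h0]), ?_⟩⟩
      rw [← abs_neg]
      convert (h y hy).2 using 2
      ring
    · intro y hy
      have hm : 1 ≤ √y := one_le_sqrt.2 hy
      have hm0 : 0 < √y := by linarith
      have h1 := abs_laplace_one_sub_le hm
      have h2 := (hB y (by linarith)).2.2.2
      rw [sq_sqrt (by linarith)] at h1
      have h3 := hbound _ _ _ _ _ hm h2 h1
      have h4 : κ * (v' y / √y) * exp (-(2 / 3 * √y ^ 3)) - √(π / √y)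
          = (κ * v' y * exp (-(2 / 3 * √y ^ 3)) - √y * √(π / √y)) / √y := by
        field_simp
      rw [h4, abs_div, abs_of_pos hm0, div_le_iff₀ hm0]
      refine h3.trans ?_
      have h5 : (κ * B + 15 / 4) / √y ^ 2 * √y = κ * B / √y + 15 / 4 / √y := by
        field_simp
      rw [h5]
      gcongr
      nlinarith
    · intro y hy hz
      have hm0 : 0 < √y := sqrt_pos.2 (by linarith)
      have hz' : v' y ≠ 0 := fun h0 => hz (by simp [h0])
      refine ((hw.deriv' y).div (hv.deriv' y) hz').neg.congr_deriv ?_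
      rw [div_pow, sq_sqrt (by linarith), inv_div]
      field_simp
      have := hW y
      field_simp at this
      linear_combination (-1) * this
    · intro y hy
      have hm : 1 ≤ √y := one_le_sqrt.2 hy
      have := (hB y (by linarith)).2.1
      rw [abs_neg, abs_div, abs_div, abs_of_pos (by linarith : 0 < √y), div_div_eq_mul_div]
      gcongr
      nlinarith

theorem exists_local_inverse_bound {φ φ' φ'' ψ ψ' : ℝ → ℝ} {t lo hi : ℝ}
    (hφ : ∀ x, HasDerivAt φ (φ' x) x) (hφ' : ∀ x, HasDerivAt φ' (φ'' x) x)
    (hψ : ∀ x, HasDerivAt ψ (ψ' x) x) (hφc : Continuous φ'') (hψc : Continuous ψ')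
    (ht : -t ∈ Icc lo hi) (hφt : φ (-t) = 0) (hd : φ' (-t) ≠ 0)
    (hne : ∀ x ∈ Icc lo hi, φ x = 0 → x = -t) :
    ∃ N, 0 ≤ N ∧ ∀ X ∈ Icc lo hi, ∀ ρ, φ X = ψ X * ρ →
      |X + t| ≤ N * |ρ| ∧ |X + t - ψ (-t) / φ' (-t) * ρ| ≤ N * ρ ^ 2 := by
  have hcφ : Continuous φ := continuous_iff_continuousAt.2 fun x => (hφ x).continuousAt
  have hcψ : Continuous ψ := continuous_iff_continuousAt.2 fun x => (hψ x).continuousAt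
  have hbound : ∀ g : ℝ → ℝ, Continuous g → ∃ K, 0 ≤ K ∧ ∀ x ∈ Icc lo hi, |g x| ≤ K := by
    intro g hg
    obtain ⟨K, hK⟩ := isCompact_Icc.exists_bound_of_continuousOn (hg.continuousOn (s := Icc lo hi))
    exact ⟨K, (norm_nonneg _).trans (hK _ ht), hK⟩
  obtain ⟨K2, hK2, hφK⟩ := hbound φ'' hφc
  obtain ⟨K1, hK1, hψK⟩ := hbound ψ' hψc
  obtain ⟨K0, hK0, hψ0⟩ := hbound ψ hcψ
  have hseg : ∀ X ∈ Icc lo hi, uIcc (-t) X ⊆ Icc lo hi := fun X hX =>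
    ordConnected_Icc.uIcc_subset ht hX
  have hψL : ∀ X ∈ Icc lo hi, |ψ X - ψ (-t)| ≤ K1 * |X + t| := fun X hX => by
    have := (convex_Icc lo hi).norm_image_sub_le_of_norm_hasDerivWithin_le
      (fun x _ => (hψ x).hasDerivWithinAt) hψK ht hX
    simpa using this
  have hφ'L : ∀ X ∈ Icc lo hi, |φ' X - φ' (-t)| ≤ K2 * |X + t| := fun X hX => by
    have := (convex_Icc lo hi).norm_image_sub_le_of_norm_hasDerivWithin_le
      (fun x _ => (hφ' x).hasDerivWithinAt) hφK ht hX
    simpa using this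
  have hφT : ∀ X ∈ Icc lo hi, |φ X - φ' (-t) * (X + t)| ≤ K2 * (X + t) ^ 2 := fun X hX => by
    have := (convex_uIcc (-t) X).norm_image_sub_le_of_norm_hasDerivWithin_le
      (f := fun x => φ x - φ' (-t) * x) (f' := fun x => φ' x - φ' (-t)) (C := K2 * |X + t|)
      (fun x _ => ((hφ x).sub ((hasDerivAt_id x).const_mul (φ' (-t)))).hasDerivWithinAt.congr_deriv
        (by simp)) (fun x hx => ?_) left_mem_uIcc right_mem_uIcc
    · rw [hφt, norm_eq_abs, norm_eq_abs, sub_neg_eq_add, mul_assoc, abs_mul_abs_self, ← sq] at this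
      convert this using 2
      ring
    · refine (hφ'L x (hseg X hX hx)).trans (mul_le_mul_of_nonneg_left ?_ hK2)
      have := abs_sub_left_of_mem_uIcc hx
      simpa using this
  obtain ⟨k, hk, hφk⟩ : ∃ k, 0 < k ∧ ∀ X ∈ Icc lo hi, k * |X + t| ≤ |φ X| := by
    have hc : Continuous (dslope φ (-t)) := by
      rw [← continuousOn_univ, continuousOn_dslope Filter.univ_mem]
      exact ⟨hcφ.continuousOn, (hφ _).differentiableAt⟩
    have hslope : ∀ X, |φ X| = |dslope φ (-t) X| * |X + t| := fun X => by
      have := sub_smul_dslope φ (-t) X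
      rw [hφt, sub_zero, sub_neg_eq_add, smul_eq_mul] at this
      rw [← this, abs_mul, mul_comm]
    obtain ⟨x0, hx0, hmin⟩ := isCompact_Icc.exists_isMinOn ⟨_, ht⟩ hc.abs.continuousOn
    refine ⟨|dslope φ (-t) x0|, abs_pos.2 fun h0 => ?_, fun X hX => ?_⟩
    · by_cases hx : x0 = -t
      · rw [hx, dslope_same, (hφ _).deriv] at h0
        exact hd h0
      · refine hx (hne x0 hx0 ?_)
        rw [← abs_eq_zero, hslope, h0]
        simp
    · rw [hslope X]
      exact mul_le_mul_of_nonneg_right (hmin hX) (abs_nonneg _)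
  set d := φ' (-t)
  set N := K0 / k
  have hN : 0 ≤ N := by positivity
  refine ⟨N + (K2 * N ^ 2 + K1 * N) / |d|, by positivity, fun X hX ρ hρ => ?_⟩
  have hd' : 0 < |d| := abs_pos.2 hd
  have h1 : |X + t| ≤ N * |ρ| := by
    rw [div_mul_eq_mul_div, le_div_iff₀ hk, mul_comm]
    refine (hφk X hX).trans ?_
    rw [hρ, abs_mul]
    exact mul_le_mul_of_nonneg_right (hψ0 X hX) (abs_nonneg _)
  have h0 : 0 ≤ (K2 * N ^ 2 + K1 * N) / |d| := by positivity
  refine ⟨h1.trans (mul_le_mul_of_nonneg_right (by linarith) (abs_nonneg _)), ?_⟩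
  have h2 : |d * (X + t) - ψ (-t) * ρ| ≤ (K2 * N ^ 2 + K1 * N) * ρ ^ 2 := by
    have e : d * (X + t) - ψ (-t) * ρ = -(φ X - d * (X + t)) + (ψ X - ψ (-t)) * ρ := by
      rw [hρ]; ring
    rw [e, ← sq_abs ρ]
    refine (abs_add_le _ _).trans ?_
    rw [abs_neg, abs_mul]
    calc |φ X - d * (X + t)| + |ψ X - ψ (-t)| * |ρ|
        ≤ K2 * (N * |ρ|) ^ 2 + K1 * (N * |ρ|) * |ρ| := by
          refine add_le_add ((hφT X hX).trans ?_) ((mul_le_mul_of_nonneg_right (hψL X hX)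
            (abs_nonneg _)).trans ?_)
          · rw [← sq_abs (X + t)]
            gcongr
          · gcongr
      _ = _ := by ring
  have h3 : X + t - ψ (-t) / d * ρ = (d * (X + t) - ψ (-t) * ρ) / d := by field_simp
  rw [h3, abs_div, div_le_iff₀ hd']
  refine h2.trans ?_
  have : (N + (K2 * N ^ 2 + K1 * N) / |d|) * ρ ^ 2 * |d|
      = N * ρ ^ 2 * |d| + (K2 * N ^ 2 + K1 * N) * ρ ^ 2 := by field_simp
  rw [this]
  have : 0 ≤ N * ρ ^ 2 * |d| := by positivity
  linarith

theorem abs_cube_expansion_le {s m : ℝ} (hs : 0 ≤ s) (hm : 0 < m) :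
    |4 / 3 * (s ^ 3 - m ^ 3) - 2 * m * (s ^ 2 - m ^ 2)| ≤ 4 / 3 * (s ^ 2 - m ^ 2) ^ 2 / m := by
  have e : 4 / 3 * (s ^ 3 - m ^ 3) - 2 * m * (s ^ 2 - m ^ 2)
      = (s - m) ^ 2 * (4 * s + 2 * m) / 3 := by ring
  rw [e, abs_of_nonneg (by positivity), le_div_iff₀ hm]
  have e2 : 4 / 3 * (s ^ 2 - m ^ 2) ^ 2 - (s - m) ^ 2 * (4 * s + 2 * m) / 3 * m
      = (s - m) ^ 2 * (4 * s ^ 2 + 4 * s * m + 2 * m ^ 2) / 3 := by ring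
  have : 0 ≤ (s - m) ^ 2 * (4 * s ^ 2 + 4 * s * m + 2 * m ^ 2) / 3 := by positivity
  linarith

set_option maxHeartbeats 1000000 in
/-- A root `X` of `φ(X) q(m² + X) = ψ(X) p(m² + X)`, where `p / q` is exponentially small, lies
exponentially close to the zero `-t` of `φ`. -/
theorem band_edge_estimate {φ φ' φ'' ψ ψ' p q : ℝ → ℝ} {t lo hi r M Y : ℝ}
    (hφ : ∀ x, HasDerivAt φ (φ' x) x) (hφ' : ∀ x, HasDerivAt φ' (φ'' x) x)
    (hψ : ∀ x, HasDerivAt ψ (ψ' x) x) (hφc : Continuous φ'') (hψc : Continuous ψ')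
    (ht' : lo = -t ∨ hi = -t) (hφt : φ (-t) = 0) (hd : φ' (-t) ≠ 0)
    (hne : ∀ x ∈ Icc lo hi, φ x = 0 → x = -t) (hY : 1 ≤ Y)
    (hpq : ∀ y, Y ≤ y → q y ≠ 0 ∧ |p y / q y - r * exp (-(4 / 3) * √y ^ 3)|
      ≤ M * exp (-(4 / 3) * √y ^ 3) / √y) :
    ∃ C, 0 < C ∧ ∀ m, 0 < m → ∀ X ∈ Icc lo hi, φ X * q (m ^ 2 + X) = ψ X * p (m ^ 2 + X) →
      |X + t - ψ (-t) / φ' (-t) * r * exp (-(4 / 3) * m ^ 3 + 2 * t * m)|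
        ≤ C / m * exp (-(4 / 3) * m ^ 3 + 2 * t * m) := by
  rcases lt_or_ge hi lo with hlt | hle
  · exact ⟨1, one_pos, fun m _ X hX => absurd (hX.1.trans hX.2) (not_le.2 hlt)⟩
  have ht : -t ∈ Icc lo hi := by
    rcases ht' with h | h <;> rw [← h]
    exacts [left_mem_Icc.2 hle, right_mem_Icc.2 hle]
  obtain ⟨N, hN, hloc⟩ := exists_local_inverse_bound hφ hφ' hψ hφc hψc ht hφt hd hne
  set κ := ψ (-t) / φ' (-t)
  have hM : 0 ≤ M := by
    by_contra h
    have h1 := (abs_nonneg _).trans (hpq Y le_rfl).2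
    have : M * exp (-(4 / 3) * √Y ^ 3) / √Y < 0 :=
      div_neg_of_neg_of_pos (mul_neg_of_neg_of_pos (not_le.1 h) (exp_pos _))
        (sqrt_pos.2 (by linarith))
    linarith
  obtain ⟨L, hL, hXL⟩ : ∃ L, 0 ≤ L ∧ ∀ X ∈ Icc lo hi, |X| ≤ L :=
    ⟨max |lo| |hi|, by positivity, fun X hX => abs_le_max_abs_abs hX.1 hX.2⟩
  set N1 := N * (4 * (|r| + M)) with hN1
  set N2 := 4 / 3 * L ^ 2 + 2 * N1 with hN2
  have hN1' : 0 ≤ N1 := by positivity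
  have hN2' : 0 ≤ N2 := by positivity
  set C1 := N * (12 * (|r| + M) ^ 2) + |κ| * (2 * |r| * N2 + 6 * M) with hC1
  have hC1' : 0 ≤ C1 := by positivity
  set m0 := 2 * L + 2 * Y + N2 with hm0
  have hm0' : 0 < m0 := by linarith
  refine ⟨C1 + m0 * ((L + |t|) * exp (4 / 3 * m0 ^ 3 + 2 * |t| * m0) + |κ * r|) + 1,
    by positivity, fun m hm X hX hXeq => ?_⟩
  set D := exp (-(4 / 3) * m ^ 3 + 2 * t * m) with hD
  have hD0 : 0 < D := exp_pos _
  rcases le_or_gt m0 m with hmm | hmm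
  · suffices h : |X + t - κ * r * D| ≤ C1 / m * D by
      refine h.trans ?_
      gcongr
      have : 0 ≤ m0 * ((L + |t|) * exp (4 / 3 * m0 ^ 3 + 2 * |t| * m0) + |κ * r|) := by positivity
      linarith
    have hm1 : 1 ≤ m := by linarith
    have hXa := abs_le.1 (hXL X hX)
    have hmsq : m ≤ m ^ 2 := by nlinarith
    have hy2 : m ^ 2 / 4 ≤ m ^ 2 + X := by linarith
    have hyY : Y ≤ m ^ 2 + X := by linarith
    obtain ⟨hq, hρ⟩ := hpq _ hyY
    have hs1 : 1 ≤ √(m ^ 2 + X) := one_le_sqrt.2 (by linarith)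
    have hs2 : m / 2 ≤ √(m ^ 2 + X) := le_sqrt_of_sq_le (by linarith [hy2, div_pow m 2 2])
    have hss : √(m ^ 2 + X) ^ 2 = m ^ 2 + X := sq_sqrt (by linarith)
    set s := √(m ^ 2 + X)
    set ρ := p (m ^ 2 + X) / q (m ^ 2 + X) with hρd
    have hs0 : 0 < s := by linarith
    obtain ⟨l1, l2⟩ := hloc X hX ρ (by rw [hρd]; field_simp; exact hXeq)
    set e := exp (-(4 / 3) * s ^ 3) with he
    have he0 : 0 < e := exp_pos _
    have hρe : |ρ| ≤ (|r| + M) * e := by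
      have h1 : M * e / s ≤ M * e := div_le_self (by positivity) hs1
      have h2 : |ρ| ≤ |ρ - r * e| + |r * e| := by
        have := abs_add_le (ρ - r * e) (r * e)
        simpa using this
      rw [abs_mul, abs_of_pos he0] at h2
      linarith
    have hem : e ≤ 4 / m ^ 2 := by
      have h1 : s ^ 2 ≤ exp (4 / 3 * s ^ 3) := by
        have := add_one_le_exp (4 / 3 * s ^ 3)
        nlinarith [mul_nonneg (by linarith : (0:ℝ) ≤ s - 1) (sq_nonneg s)]
      have h2 : (m / 2) ^ 2 ≤ exp (4 / 3 * s ^ 3) := (pow_le_pow_left₀ (by positivity) hs2 2).trans h1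
      rw [he, neg_mul, exp_neg]
      calc (exp (4 / 3 * s ^ 3))⁻¹ ≤ ((m / 2) ^ 2)⁻¹ := by gcongr
        _ = 4 / m ^ 2 := by field_simp; norm_num
    have hXt : |X + t| ≤ N1 / m ^ 2 := by
      refine l1.trans ?_
      calc N * |ρ| ≤ N * ((|r| + M) * (4 / m ^ 2)) := by
            refine mul_le_mul_of_nonneg_left (hρe.trans ?_) hN
            gcongr
        _ = N1 / m ^ 2 := by rw [hN1]; ring
    set δ := -(4 / 3) * s ^ 3 - (-(4 / 3) * m ^ 3 + 2 * t * m) with hδ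
    have heD : e = D * exp δ := by rw [he, hD, ← exp_add, hδ]; ring_nf
    have hδN : |δ| ≤ N2 / m := by
      have h1 := abs_cube_expansion_le hs0.le hm
      rw [hss, add_sub_cancel_left] at h1
      have h2 : δ = -(4 / 3 * (s ^ 3 - m ^ 3) - 2 * m * X) + -(2 * m * (X + t)) := by rw [hδ]; ring
      rw [h2]
      refine (abs_add_le _ _).trans ?_
      rw [abs_neg, abs_neg, abs_mul, abs_of_pos (by positivity : 0 < 2 * m)]
      have h3 : X ^ 2 ≤ L ^ 2 := sq_le_sq' hXa.1 hXa.2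
      calc _ ≤ 4 / 3 * L ^ 2 / m + 2 * m * (N1 / m ^ 2) := by
            refine add_le_add (h1.trans ?_) ?_ <;> gcongr
        _ = N2 / m := by rw [hN2]; field_simp
    have hδ1 : |δ| ≤ 1 := hδN.trans ((div_le_one hm).2 (by linarith))
    have hexp := abs_exp_sub_one_le hδ1
    have heD1 : |e - D| ≤ 2 * N2 * D / m := by
      have : e - D = D * (exp δ - 1) := by rw [heD]; ring
      rw [this, abs_mul, abs_of_pos hD0]
      calc D * |exp δ - 1| ≤ D * (2 * (N2 / m)) := by
            refine mul_le_mul_of_nonneg_left (hexp.trans ?_) hD0.le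
            gcongr
        _ = _ := by ring
    have he3 : e ≤ 3 * D := by
      rw [heD, mul_comm]
      refine mul_le_mul_of_nonneg_right ?_ hD0.le
      linarith [(abs_le.1 hexp).2]
    have hρD : |ρ - r * D| ≤ (2 * |r| * N2 + 6 * M) * D / m := by
      have h1 : ρ - r * D = (ρ - r * e) + r * (e - D) := by ring
      rw [h1]
      refine (abs_add_le _ _).trans ?_
      rw [abs_mul]
      calc _ ≤ M * (3 * D) / (m / 2) + |r| * (2 * N2 * D / m) := by
            refine add_le_add (hρ.trans ?_) ?_ <;> gcongr
        _ = _ := by field_simp; ring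
    have hρ2 : ρ ^ 2 ≤ 12 * (|r| + M) ^ 2 * D / m := by
      rw [← sq_abs, sq]
      have hmm : 4 / m ^ 2 ≤ 4 / m := by gcongr
      calc |ρ| * |ρ| ≤ ((|r| + M) * (3 * D)) * ((|r| + M) * (4 / m)) := by
            refine mul_le_mul (hρe.trans ?_) (hρe.trans ?_) (abs_nonneg _) (by positivity)
            · gcongr
            · exact mul_le_mul_of_nonneg_left (hem.trans hmm) (by positivity)
        _ = _ := by ring
    have hfin : X + t - κ * r * D = (X + t - κ * ρ) + κ * (ρ - r * D) := by ring
    rw [hfin]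
    refine (abs_add_le _ _).trans ?_
    rw [abs_mul]
    calc _ ≤ N * (12 * (|r| + M) ^ 2 * D / m) + |κ| * ((2 * |r| * N2 + 6 * M) * D / m) := by
          refine add_le_add (l2.trans ?_) ?_ <;> gcongr
      _ = C1 / m * D := by rw [hC1]; ring
  · have h1 : |X + t - κ * r * D| ≤ (L + |t|) + |κ * r| * D := by
      refine (abs_sub _ _).trans (add_le_add ((abs_add_le _ _).trans ?_) ?_)
      · linarith [hXL X hX]
      · rw [abs_mul, abs_of_pos hD0]
    have h2 : 1 ≤ exp (4 / 3 * m0 ^ 3 + 2 * |t| * m0) * D := by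
      rw [hD, ← exp_add, one_le_exp_iff]
      have : m ^ 3 ≤ m0 ^ 3 := by gcongr
      have h3 : |t| * m ≤ |t| * m0 := by gcongr
      have h4 : -|t| * m ≤ t * m := mul_le_mul_of_nonneg_right (neg_abs_le t) hm.le
      nlinarith
    have h3 : 1 ≤ m0 / m := (one_le_div hm).2 hmm.le
    refine h1.trans ?_
    calc (L + |t|) + |κ * r| * D
        ≤ (L + |t|) * (exp (4 / 3 * m0 ^ 3 + 2 * |t| * m0) * D) + |κ * r| * D := by
          gcongr
          exact le_mul_of_one_le_right (by positivity) h2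
      _ ≤ ((L + |t|) * (exp (4 / 3 * m0 ^ 3 + 2 * |t| * m0) * D) + |κ * r| * D) * (m0 / m) :=
          le_mul_of_one_le_right (by positivity) h3
      _ = (m0 * ((L + |t|) * exp (4 / 3 * m0 ^ 3 + 2 * |t| * m0) + |κ * r|)) / m * D := by ring
      _ ≤ _ := by
          gcongr
          linarith

theorem exists_zero_of_consecutive_zeros {f f' g g' : ℝ → ℝ} {x y : ℝ} (hxy : x < y)
    (hf : ∀ z, HasDerivAt f (f' z) z) (hg : ∀ z, HasDerivAt g (g' z) z)
    (hfx : f x = 0) (hfy : f y = 0) (hgx : g x ≠ 0) (hgy : g y ≠ 0)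
    (hW : ∀ z ∈ Ioo x y, f' z * g z - f z * g' z ≠ 0) : ∃ z ∈ Ioo x y, g z = 0 := by
  by_contra! hne
  have hne' : ∀ z ∈ Icc x y, g z ≠ 0 := fun z hz => by
    rcases eq_endpoints_or_mem_Ioo_of_mem_Icc hz with rfl | rfl | h
    exacts [hgx, hgy, hne z h]
  have hd : ∀ z ∈ Icc x y, HasDerivAt (fun z => f z / g z)
      ((f' z * g z - f z * g' z) / g z ^ 2) z := fun z hz => (hf z).div (hg z) (hne' z hz)
  obtain ⟨z, hz, h0⟩ := exists_hasDerivAt_eq_zero hxy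
    (fun z hz => (hd z hz).continuousAt.continuousWithinAt) (by simp [hfx, hfy])
    (fun z hz => hd z (Ioo_subset_Icc_self hz))
  rcases div_eq_zero_iff.1 h0 with h | h
  · exact hW z hz h
  · exact hne z hz (pow_eq_zero_iff two_ne_zero |>.1 h)

theorem lt_of_forall_between {s t : ℕ → ℝ} (hs : StrictMono s)
    (h : ∀ i, ∃ k, t i < s k ∧ s k < t (i + 1)) (j : ℕ) : s j < t (j + 1) := by
  choose k hk using h
  have hmono : StrictMono k := strictMono_nat_of_lt_succ fun i =>
    hs.lt_iff_lt.1 ((hk i).2.trans (hk (i + 1)).1)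
  exact (hs.monotone hmono.le_apply).trans_lt (hk j).2

theorem zeros_lt_of_wronskian_ne_zero {f f' g g' : ℝ → ℝ} {s t : ℕ → ℝ} (hs : StrictMono s)
    (ht : StrictMono t) (ht0 : 0 ≤ t 0)
    (hf : ∀ z, HasDerivAt f (f' z) z) (hg : ∀ z, HasDerivAt g (g' z) z)
    (hft : ∀ i, f (-t i) = 0) (hgt : ∀ i, g (-t i) ≠ 0)
    (hgs : ∀ x < 0, g x = 0 → ∃ k, x = -s k)
    (hW : ∀ x < 0, f' x * g x - f x * g' x ≠ 0) (j : ℕ) : s j < t (j + 1) := by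
  refine lt_of_forall_between hs (fun i => ?_) j
  have hti : 0 ≤ t i := ht0.trans (ht.monotone i.zero_le)
  obtain ⟨z, hz, hgz⟩ := exists_zero_of_consecutive_zeros (neg_lt_neg (ht i.lt_succ_self)) hf hg
    (hft _) (hft _) (hgt _) (hgt _) fun z hz => hW z (by linarith [hz.2])
  obtain ⟨k, rfl⟩ := hgs z (by linarith [hz.2]) hgz
  exact ⟨k, by linarith [hz.2], by linarith [hz.1]⟩

theorem AiF_eq_div (u v : ℝ → ℝ) (x : ℝ) :
    AiF u v x = (u x - v x / airyAlpha) / ((3:ℝ) ^ ((2:ℝ)/3) * Gamma (2/3)) := by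
  have h1 := Gamma_pos_of_pos (s := 1 / 3) (by norm_num)
  have h2 := Gamma_pos_of_pos (s := 2 / 3) (by norm_num)
  have h3 : (3:ℝ) ^ ((2:ℝ) / 3) = (3:ℝ) ^ ((1:ℝ) / 3) * (3:ℝ) ^ ((1:ℝ) / 3) := by
    rw [← rpow_add (by norm_num)]; norm_num
  have h4 : 0 < (3:ℝ) ^ ((1:ℝ) / 3) := by positivity
  rw [AiF, airyAlpha, h3]
  field_simp

theorem AiF_eq_zero_iff (u v : ℝ → ℝ) (x : ℝ) : AiF u v x = 0 ↔ u x - v x / airyAlpha = 0 := by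
  have h2 := Gamma_pos_of_pos (s := 2 / 3) (by norm_num)
  rw [AiF_eq_div, div_eq_zero_iff, or_iff_left (by positivity)]

theorem band_width_bound {t κ h E₁ E₂ C₁ C₂ : ℝ} (hh : 0 < h)
    (h1 : |-(h ^ (-(2:ℝ)/3)) - E₁ + t - κ * exp (-(4 / 3) * (h ^ (-(1:ℝ)/3)) ^ 3
      + 2 * t * h ^ (-(1:ℝ)/3))| ≤ C₁ / h ^ (-(1:ℝ)/3) * exp (-(4 / 3) * (h ^ (-(1:ℝ)/3)) ^ 3
      + 2 * t * h ^ (-(1:ℝ)/3)))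
    (h2 : |-(h ^ (-(2:ℝ)/3)) - E₂ + t - -κ * exp (-(4 / 3) * (h ^ (-(1:ℝ)/3)) ^ 3
      + 2 * t * h ^ (-(1:ℝ)/3))| ≤ C₂ / h ^ (-(1:ℝ)/3) * exp (-(4 / 3) * (h ^ (-(1:ℝ)/3)) ^ 3
      + 2 * t * h ^ (-(1:ℝ)/3))) :
    |(E₂ - E₁) - 2 * κ * exp (-4/(3*h) + 2 * t * h ^ (-(1:ℝ)/3))|
      ≤ (C₁ + C₂) * h ^ ((1:ℝ)/3) * exp (-4/(3*h) + 2 * t * h ^ (-(1:ℝ)/3)) := by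
  have e1 : (h ^ (-(1:ℝ)/3)) ^ 3 = h⁻¹ := by
    rw [← rpow_natCast, ← rpow_mul hh.le, ← rpow_neg_one]; norm_num
  have e2 : ∀ C : ℝ, C / h ^ (-(1:ℝ)/3) = C * h ^ ((1:ℝ)/3) := fun C => by
    rw [neg_div, rpow_neg hh.le, div_inv_eq_mul]
  have e3 : -(4 / 3) * h⁻¹ = -4 / (3 * h) := by field_simp
  rw [e1, e2, e3] at h1 h2
  set D := exp (-4/(3*h) + 2 * t * h ^ (-(1:ℝ)/3))
  have e4 : (E₂ - E₁) - 2 * κ * D = (-(h ^ (-(2:ℝ)/3)) - E₁ + t - κ * D)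
      - (-(h ^ (-(2:ℝ)/3)) - E₂ + t - -κ * D) := by ring
  rw [e4, add_mul, add_mul]
  exact (abs_sub _ _).trans (add_le_add h1 h2)

theorem rpow_neg_third_sq_add {h E : ℝ} (hh : 0 < h) :
    (h ^ (-(1:ℝ)/3)) ^ 2 + (-(h ^ (-(2:ℝ)/3)) - E) = -E := by
  have : (h ^ (-(1:ℝ)/3)) ^ 2 = h ^ (-(2:ℝ)/3) := by
    rw [← rpow_natCast, ← rpow_mul hh.le]; norm_num
  rw [this]; ring

theorem eq_of_between {s : ℕ → ℝ} (hs : StrictMonoOn s (Ici 1)) {k j : ℕ} (hk : 1 ≤ k)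
    (hl : j = 0 ∨ s j < s k) (hr : s k < s (j + 2)) : k = j + 1 := by
  have h1 : k < j + 2 := (hs.lt_iff_lt hk (by simp)).1 hr
  rcases hl with rfl | hl
  · omega
  · rcases Nat.eq_zero_or_pos j with rfl | hj
    · omega
    · have := (hs.lt_iff_lt (mem_Ici.2 hj) (mem_Ici.2 hk)).1 hl
      omega

theorem stmt_16 (u v u' v' : ℝ → ℝ)
    (hu : ∀ x, HasDerivAt u (u' x) x)
    (huAiry : ∀ x, HasDerivAt u' (x * u x) x)
    (hv : ∀ x, HasDerivAt v (v' x) x)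
    (hvAiry : ∀ x, HasDerivAt v' (x * v x) x)
    (hu0 : u 0 = 1) (hu'0 : u' 0 = 0) (hv0 : v 0 = 0) (hv'0 : v' 0 = 1)
    (a ta : ℕ → ℝ) (cc tc : ℕ → ℝ)
    (hapos : ∀ k, 1 ≤ k → 0 < a k) (htapos : ∀ k, 1 ≤ k → 0 < ta k)
    (hamono : StrictMonoOn a (Ici 1)) (htamono : StrictMonoOn ta (Ici 1))
    (hccpos : ∀ p, 0 < cc p) (htcpos : ∀ p, 0 < tc p)
    (hcc_even_mono : StrictMono (fun j => cc (2*j)))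
    (hcc_odd_mono : StrictMono (fun j => cc (2*j+1)))
    (htc_even_mono : StrictMono (fun j => tc (2*j)))
    (htc_odd_mono : StrictMono (fun j => tc (2*j+1)))
    (hzAi : ∀ x : ℝ, AiF u v x = 0 ↔ ∃ k, 1 ≤ k ∧ x = -a k)
    (hzAi' : ∀ x : ℝ, AiD u' v' x = 0 ↔ ∃ k, 1 ≤ k ∧ x = -ta k)
    (hzv' : ∀ x : ℝ, v' x = 0 ↔ ∃ j : ℕ, x = -cc (2*j))
    (hzv : ∀ x : ℝ, x < 0 → (v x = 0 ↔ ∃ j : ℕ, x = -cc (2*j+1)))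
    (hzu : ∀ x : ℝ, u x = 0 ↔ ∃ j : ℕ, x = -tc (2*j))
    (hzu' : ∀ x : ℝ, x < 0 → (u' x = 0 ↔ ∃ j : ℕ, x = -tc (2*j+1))) :
    -- Even bands: width δ_{2j} of the (2j)-th rescaled spectral band
    (∀ j : ℕ, ∃ C : ℝ, 0 < C ∧
      ∀ h : ℝ, h ∈ Ioo (0:ℝ) ((cc (2*j)) ^ (-(3:ℝ)/2)) →
        ∀ E₁ E₂ : ℝ, E₁ ≤ 0 → E₂ ≤ 0 →
          -(ta (j+1)) < -(h ^ (-(2:ℝ)/3)) - E₁ →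
          -(h ^ (-(2:ℝ)/3)) - E₁ ≤ -(if j = 0 then (0:ℝ) else tc (2*j - 1)) →
          u' (-(h ^ (-(2:ℝ)/3)) - E₁) * v' (-E₁)
            = v' (-(h ^ (-(2:ℝ)/3)) - E₁) * u' (-E₁) →
          -(cc (2*j)) ≤ -(h ^ (-(2:ℝ)/3)) - E₂ →
          -(h ^ (-(2:ℝ)/3)) - E₂ < -(ta (j+1)) →
          v (-E₂) * u' (-(h ^ (-(2:ℝ)/3)) - E₂)
            = u (-E₂) * v' (-(h ^ (-(2:ℝ)/3)) - E₂) →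
          |(E₂ - E₁)
              - 2 * Real.sqrt 3 * airyAlpha * (u' (-(ta (j+1)))) ^ 2 / ta (j+1)
                * Real.exp (-4/(3*h) + 2 * ta (j+1) * h ^ (-(1:ℝ)/3))|
            ≤ C * h ^ ((1:ℝ)/3)
                * Real.exp (-4/(3*h) + 2 * ta (j+1) * h ^ (-(1:ℝ)/3))) ∧
    -- Odd bands: width δ_{2j+1} of the (2j+1)-th rescaled spectral band
    (∀ j : ℕ, ∃ C : ℝ, 0 < C ∧
      ∀ h : ℝ, h ∈ Ioo (0:ℝ) ((cc (2*j+1)) ^ (-(3:ℝ)/2)) →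
        ∀ E₁ E₂ : ℝ, E₁ ≤ 0 → E₂ ≤ 0 →
          -(a (j+1)) < -(h ^ (-(2:ℝ)/3)) - E₁ →
          -(h ^ (-(2:ℝ)/3)) - E₁ ≤ -(tc (2*j)) →
          v' (-E₁) * u (-(h ^ (-(2:ℝ)/3)) - E₁)
            = u' (-E₁) * v (-(h ^ (-(2:ℝ)/3)) - E₁) →
          -(cc (2*j+1)) ≤ -(h ^ (-(2:ℝ)/3)) - E₂ →
          -(h ^ (-(2:ℝ)/3)) - E₂ < -(a (j+1)) →
          u (-E₂) * v (-(h ^ (-(2:ℝ)/3)) - E₂)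
            = v (-E₂) * u (-(h ^ (-(2:ℝ)/3)) - E₂) →
          |(E₂ - E₁)
              - 2 * Real.sqrt 3 * airyAlpha * (u (-(a (j+1)))) ^ 2
                * Real.exp (-4/(3*h) + 2 * a (j+1) * h ^ (-(1:ℝ)/3))|
            ≤ C * h ^ ((1:ℝ)/3)
                * Real.exp (-4/(3*h) + 2 * a (j+1) * h ^ (-(1:ℝ)/3))) := by
  have hU : IsAirySolution u u' := ⟨hu, huAiry⟩
  have hV : IsAirySolution v v' := ⟨hv, hvAiry⟩
  have hα := airyAlpha_pos
  have hWr := hU.sub_div_const hV airyAlpha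
  have hwv : ∀ x, (u x - v x / airyAlpha) * v' x - (u' x - v' x / airyAlpha) * v x = 1 := by
    intro x
    have := hWr.wronskian_eq hV x 0
    simpa [hu0, hu'0, hv0, hv'0] using this
  have huv : ∀ x, u x * v' x - u' x * v x = 1 := by
    intro x
    have := hU.wronskian_eq hV x 0
    simpa [hu0, hu'0, hv0, hv'0] using this
  obtain ⟨⟨M₀, Y₀, hY₀, hratio⟩, ⟨M₁, Y₁, hY₁, hratio'⟩⟩ :=
    recessive_ratio_asymptotics hU hV hu0 hu'0 hv0 hv'0
  have hzw : ∀ x, u x - v x / airyAlpha = 0 ↔ ∃ k, 1 ≤ k ∧ x = -a k := fun x => by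
    rw [← AiF_eq_zero_iff, hzAi]
  have hzw' : ∀ x, u' x - v' x / airyAlpha = 0 ↔ ∃ k, 1 ≤ k ∧ x = -ta k := fun x => by
    rw [← AiF_eq_zero_iff]; exact hzAi' x
  set w : ℝ → ℝ := fun x => u x - v x / airyAlpha with hw
  set w' : ℝ → ℝ := fun x => u' x - v' x / airyAlpha with hw'
  have hcont : ∀ {f f' : ℝ → ℝ}, (∀ x, HasDerivAt f (f' x) x) → Continuous f := fun hf =>
    continuous_iff_continuousAt.2 fun x => (hf x).continuousAt
  have hcw : Continuous w := hcont hWr.deriv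
  have hcw' : Continuous w' := hcont hWr.deriv'
  have hcv : Continuous v := hcont hv
  have hcv' : Continuous v' := hcont hvAiry
  have hw'' : ∀ x, HasDerivAt (fun x => x * w x) (w x + x * w' x) x := fun x =>
    ((hasDerivAt_id x).mul (hWr.deriv x)).congr_deriv (by simp)
  have hamono' : StrictMono fun k => a (k + 1) := fun i k hik =>
    hamono (by simp) (by simp) (by omega)
  have htamono' : StrictMono fun k => ta (k + 1) := fun i k hik =>
    htamono (by simp) (by simp) (by omega)
  constructor
  · intro j
    have ht := htapos (j + 1) (by omega)
    have hwt : w' (-ta (j + 1)) = 0 := (hzw' _).2 ⟨j + 1, by omega, rfl⟩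
    have hvt : v' (-ta (j + 1)) = airyAlpha * u' (-ta (j + 1)) := by
      have : u' (-ta (j + 1)) - v' (-ta (j + 1)) / airyAlpha = 0 := hwt
      field_simp at this
      linarith
    have hwvt : w (-ta (j + 1)) * v' (-ta (j + 1)) = 1 := by
      have : w (-ta (j + 1)) * v' (-ta (j + 1)) - w' (-ta (j + 1)) * v (-ta (j + 1)) = 1 :=
        hwv _
      rwa [hwt, zero_mul, sub_zero] at this
    have hwt0 : w (-ta (j + 1)) ≠ 0 := left_ne_zero_of_mul_eq_one hwvt
    have hd : -ta (j + 1) * w (-ta (j + 1)) ≠ 0 := mul_ne_zero (by linarith) hwt0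
    have hlo : cc (2 * j) < ta (j + 2) := by
      refine zeros_lt_of_wronskian_ne_zero (f := w') (g := v') hcc_even_mono htamono'
        (htapos 1 le_rfl).le hWr.deriv' hvAiry (fun i => (hzw' _).2 ⟨i + 1, by omega, rfl⟩)
        (fun i h0 => ?_) (fun x _ hx => (hzv' x).1 hx) (fun x hx h0 => ?_) j
      · have h1 : w' (-ta (i + 1)) = 0 := (hzw' _).2 ⟨i + 1, by omega, rfl⟩
        have h2 : w (-ta (i + 1)) * v' (-ta (i + 1)) - w' (-ta (i + 1)) * v (-ta (i + 1)) = 1 :=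
          hwv _
        rw [h1, h0] at h2
        norm_num at h2
      · have h2 : w x * v' x - w' x * v x = 1 := hwv x
        exact hx.ne (by linear_combination h0 - x * h2)
    have hhi : j = 0 ∨ ta j < tc (2 * j - 1) := by
      rcases j with _ | j
      · exact Or.inl rfl
      right
      set T : ℕ → ℝ := fun i => Nat.casesOn i 0 fun i => tc (2 * i + 1) with hT
      have hTmono : StrictMono T := by
        refine strictMono_nat_of_lt_succ fun i => ?_
        rcases i with _ | i
        · exact htcpos 1
        · exact htc_odd_mono i.lt_succ_self
      have hTpos : ∀ i, 0 < T (i + 1) := fun i => htcpos _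
      have hTu : ∀ i, u' (-T i) = 0 := fun i => by
        rcases i with _ | i
        · simpa [hT] using hu'0
        · exact (hzu' _ (by linarith [hTpos i])).2 ⟨i, rfl⟩
      have hTw : ∀ i, w' (-T i) ≠ 0 := fun i h0 => by
        have h1 : u' (-T i) - v' (-T i) / airyAlpha = 0 := h0
        rw [hTu, zero_sub, neg_eq_zero, div_eq_zero_iff, or_iff_left hα.ne'] at h1
        have := huv (-T i)
        rw [h1, hTu] at this
        norm_num at this
      refine zeros_lt_of_wronskian_ne_zero (f := u') (g := w') (t := T) htamono' hTmono le_rfl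
        huAiry hWr.deriv' hTu hTw (fun x _ hx => ?_) (fun x hx h0 => ?_) j
      · obtain ⟨k, hk, rfl⟩ := (hzw' x).1 hx
        exact ⟨k - 1, by simp only [Nat.sub_add_cancel hk]⟩
      · have h2 := huv x
        have h3 : -x * (u x * v' x - u' x * v x) / airyAlpha = 0 := by
          rw [← h0, hw']; ring
        rw [h2, mul_one] at h3
        exact hx.ne (by simpa [hα.ne'] using h3)
    have hcoef : v' (-ta (j + 1)) / (-ta (j + 1) * w (-ta (j + 1))) * (√3 / airyAlpha)
        = -(√3 * airyAlpha * u' (-ta (j + 1)) ^ 2 / ta (j + 1)) := by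
      have h1 : v' (-ta (j + 1)) / (-ta (j + 1) * w (-ta (j + 1)))
          = -(v' (-ta (j + 1)) ^ 2 / ta (j + 1)) := by
        rw [div_eq_iff hd]
        field_simp
        linear_combination (-v' (-ta (j + 1))) * hwvt
      rw [h1, hvt]
      field_simp
    obtain ⟨C₁, hC₁, hE₁⟩ := band_edge_estimate (φ := w') (ψ := v') (p := w') (q := v')
      (lo := -ta (j + 1)) (hi := -(if j = 0 then (0:ℝ) else tc (2*j - 1)))
      hWr.deriv' hw'' hvAiry (hcw.add (continuous_id.mul hcw')) (continuous_id.mul hcv)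
      (Or.inl rfl) hwt hd (fun x hx h0 => by
        obtain ⟨k, hk, rfl⟩ := (hzw' x).1 h0
        rw [eq_of_between htamono hk (or_iff_not_imp_left.2 fun hj => ?_) (lt_of_le_of_lt
          (neg_le_neg_iff.1 hx.1) (htamono' j.lt_succ_self))]
        have := neg_le_neg_iff.1 hx.2
        rw [if_neg hj] at this
        exact (hhi.resolve_left hj).trans_le this) hY₁ hratio'
    obtain ⟨C₂, hC₂, hE₂⟩ := band_edge_estimate (φ := w') (ψ := v') (p := w) (q := v)
      (lo := -cc (2 * j)) (hi := -ta (j + 1))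
      hWr.deriv' hw'' hvAiry (hcw.add (continuous_id.mul hcw')) (continuous_id.mul hcv)
      (Or.inr rfl) hwt hd (fun x hx h0 => by
        obtain ⟨k, hk, rfl⟩ := (hzw' x).1 h0
        rw [eq_of_between htamono hk (or_iff_not_imp_left.2 fun hj => ?_)
          (lt_of_le_of_lt (neg_le_neg_iff.1 hx.1) hlo)]
        exact (htamono (mem_Ici.2 (Nat.pos_of_ne_zero hj)) (by simp) j.lt_succ_self).trans_le
          (neg_le_neg_iff.1 hx.2)) hY₀ hratio
    refine ⟨C₁ + C₂, by positivity, fun h hh E₁ E₂ _ _ hl₁ hr₁ heq₁ hl₂ hr₂ heq₂ => ?_⟩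
    have hm : 0 < h ^ (-(1:ℝ)/3) := rpow_pos_of_pos hh.1 _
    have b₁ := hE₁ _ hm _ ⟨hl₁.le, hr₁⟩ (by
      rw [rpow_neg_third_sq_add hh.1]
      simp only [hw']
      linear_combination heq₁)
    have b₂ := hE₂ _ hm _ ⟨hl₂, hr₂.le⟩ (by
      rw [rpow_neg_third_sq_add hh.1]
      simp only [hw, hw']
      linear_combination heq₂)
    rw [mul_neg, hcoef, neg_neg] at b₁
    rw [hcoef] at b₂
    convert band_width_bound hh.1 b₁ b₂ using 3
    ring
  · intro j
    have hwt : w (-a (j + 1)) = 0 := (hzw _).2 ⟨j + 1, by omega, rfl⟩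
    have hvt : v (-a (j + 1)) = airyAlpha * u (-a (j + 1)) := by
      have : u (-a (j + 1)) - v (-a (j + 1)) / airyAlpha = 0 := hwt
      field_simp at this
      linarith
    have hwvt : -(w' (-a (j + 1)) * v (-a (j + 1))) = 1 := by
      have : w (-a (j + 1)) * v' (-a (j + 1)) - w' (-a (j + 1)) * v (-a (j + 1)) = 1 :=
        hwv _
      rwa [hwt, zero_mul, zero_sub] at this
    have hd : w' (-a (j + 1)) ≠ 0 := fun h0 => by norm_num [h0] at hwvt
    have hlo : cc (2 * j + 1) < a (j + 2) := by
      refine zeros_lt_of_wronskian_ne_zero (f := w) (g := v) hcc_odd_mono hamono'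
        (hapos 1 le_rfl).le hWr.deriv hv (fun i => (hzw _).2 ⟨i + 1, by omega, rfl⟩)
        (fun i h0 => ?_) (fun x hx hx0 => (hzv x hx).1 hx0) (fun x hx h0 => ?_) j
      · have h1 : w (-a (i + 1)) = 0 := (hzw _).2 ⟨i + 1, by omega, rfl⟩
        have h2 : w (-a (i + 1)) * v' (-a (i + 1)) - w' (-a (i + 1)) * v (-a (i + 1)) = 1 :=
          hwv _
        rw [h1, h0] at h2
        norm_num at h2
      · have h2 : w x * v' x - w' x * v x = 1 := hwv x
        linarith
    have hhi : j = 0 ∨ a j < tc (2 * j) := by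
      rcases j with _ | j
      · exact Or.inl rfl
      right
      have hTu : ∀ i, u (-tc (2 * i)) = 0 := fun i => (hzu _).2 ⟨i, rfl⟩
      have hTw : ∀ i, w (-tc (2 * i)) ≠ 0 := fun i h0 => by
        have h1 : u (-tc (2 * i)) - v (-tc (2 * i)) / airyAlpha = 0 := h0
        rw [hTu, zero_sub, neg_eq_zero, div_eq_zero_iff, or_iff_left hα.ne'] at h1
        have := huv (-tc (2 * i))
        rw [h1, hTu] at this
        norm_num at this
      refine zeros_lt_of_wronskian_ne_zero (f := u) (g := w) hamono' htc_even_mono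
        (htcpos 0).le hu hWr.deriv hTu hTw (fun x _ hx => ?_) (fun x hx h0 => ?_) j
      · obtain ⟨k, hk, rfl⟩ := (hzw x).1 hx
        exact ⟨k - 1, by simp only [Nat.sub_add_cancel hk]⟩
      · have h2 := huv x
        have h3 : (u x * v' x - u' x * v x) / airyAlpha = 0 := by
          rw [← h0, hw, hw']; ring
        rw [h2] at h3
        exact (one_div_pos.2 hα).ne' h3
    have hcoef : v (-a (j + 1)) / w' (-a (j + 1)) * (√3 / airyAlpha)
        = -(√3 * airyAlpha * u (-a (j + 1)) ^ 2) := by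
      have h1 : v (-a (j + 1)) / w' (-a (j + 1)) = -v (-a (j + 1)) ^ 2 := by
        rw [div_eq_iff hd]
        linear_combination (-v (-a (j + 1))) * hwvt
      rw [h1, hvt]
      field_simp
    obtain ⟨C₁, hC₁, hE₁⟩ := band_edge_estimate (φ := w) (ψ := v) (p := w') (q := v')
      (lo := -a (j + 1)) (hi := -tc (2 * j))
      hWr.deriv hWr.deriv' hv (continuous_id.mul hcw) hcv'
      (Or.inl rfl) hwt hd (fun x hx h0 => by
        obtain ⟨k, hk, rfl⟩ := (hzw x).1 h0
        rw [eq_of_between hamono hk (hhi.imp_right fun h => h.trans_le (neg_le_neg_iff.1 hx.2))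
          (lt_of_le_of_lt (neg_le_neg_iff.1 hx.1) (hamono' j.lt_succ_self))]) hY₁ hratio'
    obtain ⟨C₂, hC₂, hE₂⟩ := band_edge_estimate (φ := w) (ψ := v) (p := w) (q := v)
      (lo := -cc (2 * j + 1)) (hi := -a (j + 1))
      hWr.deriv hWr.deriv' hv (continuous_id.mul hcw) hcv'
      (Or.inr rfl) hwt hd (fun x hx h0 => by
        obtain ⟨k, hk, rfl⟩ := (hzw x).1 h0
        rw [eq_of_between hamono hk (or_iff_not_imp_left.2 fun hj => ?_)
          (lt_of_le_of_lt (neg_le_neg_iff.1 hx.1) hlo)]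
        exact (hamono (mem_Ici.2 (Nat.pos_of_ne_zero hj)) (by simp) j.lt_succ_self).trans_le
          (neg_le_neg_iff.1 hx.2)) hY₀ hratio
    refine ⟨C₁ + C₂, by positivity, fun h hh E₁ E₂ _ _ hl₁ hr₁ heq₁ hl₂ hr₂ heq₂ => ?_⟩
    have hm : 0 < h ^ (-(1:ℝ)/3) := rpow_pos_of_pos hh.1 _
    have b₁ := hE₁ _ hm _ ⟨hl₁.le, hr₁⟩ (by
      rw [rpow_neg_third_sq_add hh.1]
      simp only [hw, hw']
      linear_combination heq₁)
    have b₂ := hE₂ _ hm _ ⟨hl₂, hr₂.le⟩ (by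
      rw [rpow_neg_third_sq_add hh.1]
      simp only [hw]
      linear_combination -heq₂)
    rw [mul_neg, hcoef, neg_neg] at b₁
    rw [hcoef] at b₂
    convert band_width_bound hh.1 b₁ b₂ using 3
    ring
end
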